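/- arXiv:math/0506411 — 3 statements merged into one kernel-verified Lean document; each statement's English description precedes it below -/
import Mathlib

section
/- Let Q ∈ L²_loc(ℝ; ℝ), q = Q', and suppose L_q ≥ 0, i.e. ∫ φ'(x)² dx − 2∫ Q(x) φ(x) φ'(x) dx ≥ 0 for every φ ∈ C_c^∞(ℝ; ℝ). Then the equation L_q y = 0 has a strictly positive solution: there exists a solution y of L_q y = 0 on ℝ (in the system sense) with y(x) > 0 for all x ∈ ℝ. -/
open MeasureTheory Filter Set intervalIntegral ENNReal

/-- `Q : ℝ → ℝ` is (real-valued and) locally square integrable on `ℝ`. -/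
def LocL2 (Q : ℝ → ℝ) : Prop :=
  Measurable Q ∧ ∀ a b : ℝ, IntegrableOn (fun x => Q x ^ 2) (Set.Icc a b) volume

/-- `y` together with the companion function `u` (representing `u = y' - Q·y`) solves the
first-order system `y' = Q y + u`, `u' = -Q² y - Q u` equivalent to `L_q y = 0` with `q = Q'`,
expressed through integral equations (encoding local absolute continuity). -/
def SolvesWith (Q y u : ℝ → ℝ) : Prop :=
  (∀ x : ℝ, y x = y 0 + ∫ t in (0:ℝ)..x, (Q t * y t + u t)) ∧
  (∀ x : ℝ, u x = u 0 + ∫ t in (0:ℝ)..x, (-(Q t) ^ 2 * y t - Q t * u t))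

/-- `y` solves `L_q y = 0` on `ℝ` in the system sense, `q = Q'`. -/
def Solves (Q y : ℝ → ℝ) : Prop := ∃ u : ℝ → ℝ, SolvesWith Q y u

/-- `L_q ≥ 0` for `q = Q'`: for every real-valued test function `φ`,
`∫ φ'² dx - 2 ∫ Q φ φ' dx ≥ 0` (the second term is the pairing `(q, φ²)`). -/
def LqNonneg (Q : ℝ → ℝ) : Prop :=
  ∀ φ : ℝ → ℝ, ContDiff ℝ (⊤ : ℕ∞) φ → HasCompactSupport φ →
    0 ≤ (∫ x : ℝ, deriv φ x ^ 2) - 2 * ∫ x : ℝ, Q x * φ x * deriv φ x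

/-- The Riccati relation `q = B(r) = r' + r²` for `q = Q'`: there is a constant `C` with
`r x + ∫₀ˣ r² = Q x + C` for almost every `x`. -/
def Riccati (Q r : ℝ → ℝ) : Prop :=
  ∃ C : ℝ, ∀ᵐ x : ℝ ∂volume, r x + (∫ s in (0:ℝ)..x, r s ^ 2) = Q x + C

lemma locallyIntegrable_mul_continuous {f g : ℝ → ℝ} (hf : LocallyIntegrable f)
    (hg : Continuous g) : LocallyIntegrable fun x => f x * g x :=
  locallyIntegrable_iff.2 fun _ hK =>
    (hf.integrableOn_isCompact hK).mul_continuousOn hg.continuousOn hK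

/-- The weight `exp (2 |∫₀ˣ k|)` reproduces itself up to a factor `1/2` under integration
against `k`. -/
lemma abs_integral_mul_exp_weight_le {k : ℝ → ℝ} (hk : LocallyIntegrable k) (hk0 : ∀ t, 0 ≤ k t)
    (x : ℝ) :
    |∫ t in (0 : ℝ)..x, k t * Real.exp (2 * |∫ s in (0 : ℝ)..t, k s|)| ≤
      (Real.exp (2 * |∫ s in (0 : ℝ)..x, k s|) - 1) / 2 := by
  have hki (a b : ℝ) : IntervalIntegrable k volume a b :=
    (hk.integrableOn_isCompact isCompact_uIcc).intervalIntegrable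
  set K : ℝ → ℝ := fun t => ∫ s in (0 : ℝ)..t, k s with hK
  have hK0 : K 0 = 0 := by simp [hK]
  have hmono : Monotone K := by
    intro a b hab
    have h1 : K b - K a = ∫ s in a..b, k s := integral_interval_sub_left (hki _ _) (hki _ _)
    have h2 := integral_nonneg (μ := volume) hab fun t _ => hk0 t
    linarith
  have hder : ∀ᵐ t, HasDerivAt K (k t) t := by
    filter_upwards [_root_.LocallyIntegrable.ae_hasDerivAt_integral hk] with t ht using ht 0
  rcases le_total 0 x with hx | hx
  · set f : ℝ → ℝ := fun t => Real.exp (2 * K t) with hf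
    have hfm : Monotone f := fun a b hab => Real.exp_le_exp.2 (by linarith [hmono hab])
    have h1 := (hfm.monotoneOn (uIcc 0 x)).intervalIntegral_deriv_mem_uIcc
    have h2 : ∫ t in (0 : ℝ)..x, deriv f t = 2 * ∫ t in (0 : ℝ)..x, k t * Real.exp (2 * |K t|) := by
      rw [← intervalIntegral.integral_const_mul]
      apply intervalIntegral.integral_congr_ae
      filter_upwards [hder] with t ht hmem
      rw [uIoc_of_le hx] at hmem
      have h3 : 0 ≤ K t := hK0 ▸ hmono hmem.1.le
      rw [((ht.const_mul 2).exp).deriv, abs_of_nonneg h3]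
      ring
    have h4 : 0 ≤ K x := hK0 ▸ hmono hx
    have h5 : f 0 ≤ f x := hfm hx
    rw [h2, uIcc_of_le (by linarith)] at h1
    have h6 : f 0 = 1 := by simp [hf, hK0]
    have h7 : f x = Real.exp (2 * |K x|) := by rw [abs_of_nonneg h4]
    rw [← h7, abs_le]
    constructor <;> linarith [h1.1, h1.2]
  · set f : ℝ → ℝ := fun t => -Real.exp (-2 * K t) with hf
    have hfm : Monotone f := fun a b hab =>
      neg_le_neg (Real.exp_le_exp.2 (by linarith [hmono hab]))
    have h1 := (hfm.monotoneOn (uIcc 0 x)).intervalIntegral_deriv_mem_uIcc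
    have h2 : ∫ t in (0 : ℝ)..x, deriv f t = 2 * ∫ t in (0 : ℝ)..x, k t * Real.exp (2 * |K t|) := by
      rw [← intervalIntegral.integral_const_mul]
      apply intervalIntegral.integral_congr_ae
      filter_upwards [hder] with t ht hmem
      rw [uIoc_of_ge hx] at hmem
      have h3 : K t ≤ 0 := hK0 ▸ hmono hmem.2
      rw [(show HasDerivAt f _ t from (ht.const_mul (-2)).exp.neg).deriv, abs_of_nonpos h3]
      ring_nf
    have h4 : K x ≤ 0 := hK0 ▸ hmono hx
    have h5 : f x ≤ f 0 := hfm hx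
    rw [h2, uIcc_of_ge (by linarith)] at h1
    have h6 : f 0 = -1 := by simp [hf, hK0]
    have h7 : f x = -Real.exp (2 * |K x|) := by
      rw [abs_of_nonpos h4]
      simp [hf]
    rw [abs_le]
    constructor <;> linarith [h1.1, h1.2]

/-- Global existence for linear Carathéodory systems with locally integrable coefficients. -/
lemma exists_continuous_linear_integral_equation {E : Type*} [NormedAddCommGroup E]
    [NormedSpace ℝ E] [CompleteSpace E] {A : ℝ → E →L[ℝ] E} (hA : LocallyIntegrable A) (v : E) :
    ∃ Y : ℝ → E, (∀ a b, IntervalIntegrable (fun t => A t (Y t)) volume a b) ∧ Continuous Y ∧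
      ∀ x, Y x = v + ∫ t in (0 : ℝ)..x, A t (Y t) := by
  set W : ℝ → ℝ := fun x => Real.exp (2 * |∫ t in (0 : ℝ)..x, ‖A t‖|) with hW
  have hAi (a b : ℝ) : IntervalIntegrable (fun t => ‖A t‖) volume a b :=
    IntegrableOn.intervalIntegrable (hA.integrableOn_isCompact isCompact_uIcc).norm
  have hWc : Continuous W :=
    Real.continuous_exp.comp
      (continuous_const.mul (continuous_primitive hAi 0).abs)
  have hWpos (x : ℝ) : 0 < W x := Real.exp_pos _
  have hW1 (x : ℝ) : 1 ≤ W x := Real.one_le_exp (by positivity)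
  have hWint (x : ℝ) : |∫ t in (0 : ℝ)..x, ‖A t‖ * W t| ≤ (W x - 1) / 2 :=
    abs_integral_mul_exp_weight_le
      (locallyIntegrable_iff.2 fun _ hK => (hA.integrableOn_isCompact hK).norm)
      (fun t => norm_nonneg _) x
  have hint {Z : ℝ → E} (hZ : Continuous Z) (a b : ℝ) :
      IntervalIntegrable (fun t => A t (Z t)) volume a b := by
    have h1 : IntervalIntegrable (fun t => ‖A t‖ * ‖Z t‖) volume a b :=
      (hAi a b).mul_continuousOn hZ.norm.continuousOn
    refine h1.mono_fun ?_ (.of_forall fun t => ?_)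
    · have happly := (isBoundedBilinearMap_apply (𝕜 := ℝ) (E := E) (F := E)).continuous
      exact happly.comp_aestronglyMeasurable
        (hA.aestronglyMeasurable.restrict.prodMk hZ.aestronglyMeasurable)
    · simpa using (A t).le_opNorm (Z t)
  have hbound {Z : ℝ → E} {C : ℝ} (hC : 0 ≤ C) (hZC : ∀ t, ‖Z t‖ ≤ C * W t) (x : ℝ) :
      ‖∫ t in (0 : ℝ)..x, A t (Z t)‖ ≤ C / 2 * W x := by
    have h1 : IntervalIntegrable (fun t => C * (‖A t‖ * W t)) volume 0 x :=
      ((hAi 0 x).mul_continuousOn hWc.continuousOn).const_mul C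
    refine (norm_integral_le_abs_of_norm_le (.of_forall fun t => ?_) h1).trans ?_
    · calc ‖A t (Z t)‖ ≤ ‖A t‖ * ‖Z t‖ := (A t).le_opNorm _
        _ ≤ ‖A t‖ * (C * W t) := by gcongr; exact hZC t
        _ = C * (‖A t‖ * W t) := by ring
    · rw [intervalIntegral.integral_const_mul, abs_mul, abs_of_nonneg hC]
      calc C * |∫ t in (0 : ℝ)..x, ‖A t‖ * W t| ≤ C * ((W x - 1) / 2) := by
            gcongr; exact hWint x
        _ ≤ C / 2 * W x := by nlinarith
  have hcomp (Z : BoundedContinuousFunction ℝ E) : Continuous fun t => W t • Z t :=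
    hWc.smul Z.continuous
  have hsize (Z : BoundedContinuousFunction ℝ E) (t : ℝ) : ‖W t • Z t‖ ≤ ‖Z‖ * W t := by
    rw [norm_smul, Real.norm_of_nonneg (hWpos t).le, mul_comm]
    exact mul_le_mul_of_nonneg_right (Z.norm_coe_le_norm t) (hWpos t).le
  let T (Z : BoundedContinuousFunction ℝ E) : BoundedContinuousFunction ℝ E :=
    BoundedContinuousFunction.ofNormedAddCommGroup
      (fun x => (W x)⁻¹ • (v + ∫ t in (0 : ℝ)..x, A t (W t • Z t)))
      ((hWc.inv₀ fun x => (hWpos x).ne').smul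
        (continuous_const.add (continuous_primitive (hint (hcomp Z)) 0)))
      (‖v‖ + ‖Z‖ / 2) (by
        intro x
        rw [norm_smul, norm_inv, Real.norm_of_nonneg (hWpos x).le,
          inv_mul_le_iff₀ (hWpos x)]
        refine (norm_add_le _ _).trans ?_
        have h1 := hbound (norm_nonneg Z) (hsize Z) x
        nlinarith [norm_nonneg v, hW1 x])
  have hT : ContractingWith (1 / 2) T := by
    refine ⟨by norm_num, LipschitzWith.of_dist_le_mul fun Z Z' => ?_⟩
    rw [BoundedContinuousFunction.dist_le (by positivity)]
    intro x
    have h1 : T Z x - T Z' x = (W x)⁻¹ • ∫ t in (0 : ℝ)..x, A t (W t • (Z - Z') t) := by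
      simp only [T, BoundedContinuousFunction.coe_ofNormedAddCommGroup, ← smul_sub,
        add_sub_add_left_eq_sub]
      rw [← intervalIntegral.integral_sub (hint (hcomp Z) _ _) (hint (hcomp Z') _ _)]
      simp [smul_sub]
    rw [dist_eq_norm, h1, norm_smul, norm_inv, Real.norm_of_nonneg (hWpos x).le,
      inv_mul_le_iff₀ (hWpos x), dist_eq_norm]
    have h2 := hbound (norm_nonneg (Z - Z')) (hsize (Z - Z')) x
    refine h2.trans (le_of_eq ?_)
    push_cast
    ring
  obtain ⟨Z, hZ⟩ : ∃ Z, T Z = Z := ⟨_, hT.fixedPoint_isFixedPt⟩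
  refine ⟨fun x => W x • Z x, hint (hcomp Z), hcomp Z, fun x => ?_⟩
  have h1 : Z x = (W x)⁻¹ • (v + ∫ t in (0 : ℝ)..x, A t (W t • Z t)) := by
    conv_lhs => rw [← hZ]
    rfl
  change W x • Z x = _
  rw [h1, smul_smul, mul_inv_cancel₀ (hWpos x).ne', one_smul]

/-- `f` is an antiderivative of the locally integrable function `f'`. -/
structure IsPrimitive (f f' : ℝ → ℝ) : Prop where
  locallyIntegrable : LocallyIntegrable f'
  integral_eq : ∀ a b : ℝ, ∫ t in a..b, f' t = f b - f a

namespace IsPrimitive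

variable {f f' g g' : ℝ → ℝ}

lemma intervalIntegrable (h : IsPrimitive f f') (a b : ℝ) : IntervalIntegrable f' volume a b :=
  (h.locallyIntegrable.integrableOn_isCompact isCompact_uIcc).intervalIntegrable

lemma of_integral_zero_eq (hf' : LocallyIntegrable f')
    (h : ∀ x, f x = f 0 + ∫ t in (0 : ℝ)..x, f' t) : IsPrimitive f f' := by
  refine ⟨hf', fun a b => ?_⟩
  have hi (a b : ℝ) : IntervalIntegrable f' volume a b :=
    (hf'.integrableOn_isCompact isCompact_uIcc).intervalIntegrable
  rw [h a, h b, add_sub_add_left_eq_sub, integral_interval_sub_left (hi _ _) (hi _ _)]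

lemma eq_add_integral (h : IsPrimitive f f') (a x : ℝ) : f x = f a + ∫ t in a..x, f' t := by
  rw [h.integral_eq]
  ring

lemma continuous (h : IsPrimitive f f') : Continuous f := by
  rw [funext (h.eq_add_integral 0)]
  exact continuous_const.add (continuous_primitive h.intervalIntegrable 0)

lemma ae_hasDerivAt (h : IsPrimitive f f') : ∀ᵐ x, HasDerivAt f (f' x) x := by
  filter_upwards [_root_.LocallyIntegrable.ae_hasDerivAt_integral h.locallyIntegrable] with x hx
  rw [funext (h.eq_add_integral 0)]
  exact (hx 0).const_add _

lemma absolutelyContinuousOnInterval (h : IsPrimitive f f') (a b : ℝ) :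
    AbsolutelyContinuousOnInterval f a b := by
  have h1 := (h.intervalIntegrable a b).absolutelyContinuousOnInterval_intervalIntegral
    (c := a) left_mem_uIcc
  have h2 : AbsolutelyContinuousOnInterval (fun _ : ℝ => f a) a b :=
    contDiff_const.contDiffOn.absolutelyContinuousOnInterval
  rw [funext (h.eq_add_integral a)]
  exact h2.add h1

lemma add (hf : IsPrimitive f f') (hg : IsPrimitive g g') :
    IsPrimitive (fun x => f x + g x) (fun x => f' x + g' x) := by
  refine ⟨hf.locallyIntegrable.add hg.locallyIntegrable, fun a b => ?_⟩
  rw [intervalIntegral.integral_add (hf.intervalIntegrable a b) (hg.intervalIntegrable a b),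
    hf.integral_eq, hg.integral_eq]
  ring

lemma const_mul (c : ℝ) (hf : IsPrimitive f f') :
    IsPrimitive (fun x => c * f x) (fun x => c * f' x) := by
  refine ⟨hf.locallyIntegrable.smul c, fun a b => ?_⟩
  rw [intervalIntegral.integral_const_mul, hf.integral_eq]
  ring

lemma mul (hf : IsPrimitive f f') (hg : IsPrimitive g g') :
    IsPrimitive (fun x => f x * g x) (fun x => f' x * g x + f x * g' x) := by
  refine ⟨?_, fun a b => ?_⟩
  · refine (locallyIntegrable_mul_continuous hf.locallyIntegrable hg.continuous).add ?_
    simpa only [mul_comm] using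
      locallyIntegrable_mul_continuous hg.locallyIntegrable hf.continuous
  · rw [← (hf.absolutelyContinuousOnInterval a b).integral_deriv_mul_eq_sub
      (hg.absolutelyContinuousOnInterval a b)]
    apply intervalIntegral.integral_congr_ae
    filter_upwards [hf.ae_hasDerivAt, hg.ae_hasDerivAt] with x h1 h2 _
    rw [h1.deriv, h2.deriv]

lemma of_contDiff (hf : ContDiff ℝ 1 f) : IsPrimitive f (deriv f) := by
  refine ⟨(hf.continuous_deriv le_rfl).locallyIntegrable, fun a b => ?_⟩
  exact integral_deriv_eq_sub (fun x _ => (hf.differentiable one_ne_zero) x)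
    ((hf.continuous_deriv le_rfl).intervalIntegrable _ _)

/-- Extension by zero of an antiderivative vanishing at both ends of an interval. -/
lemma indicator {a b : ℝ} (hab : a ≤ b) (hf : IsPrimitive f f') (ha : f a = 0) (hb : f b = 0) :
    IsPrimitive ((Icc a b).indicator f) ((Ioc a b).indicator f') := by
  have hloc : LocallyIntegrable ((Ioc a b).indicator f') :=
    hf.locallyIntegrable.indicator measurableSet_Ioc
  have hi (c d : ℝ) : IntervalIntegrable ((Ioc a b).indicator f') volume c d :=
    (hloc.integrableOn_isCompact isCompact_uIcc).intervalIntegrable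
  have key (x : ℝ) : ∫ t in a..x, (Ioc a b).indicator f' t = (Icc a b).indicator f x := by
    rcases lt_or_ge x a with hx | hx
    · rw [integral_of_ge hx.le, setIntegral_indicator measurableSet_Ioc,
        Ioc_inter_Ioc, Ioc_eq_empty (by simp [hx.le]), indicator_of_notMem (by simp [hx])]
      simp
    · rw [integral_of_le hx, setIntegral_indicator measurableSet_Ioc, Ioc_inter_Ioc, sup_idem,
        ← integral_of_le (le_min hx hab), hf.integral_eq, ha]
      rcases le_total x b with hxb | hxb
      · rw [indicator_of_mem (mem_Icc.2 ⟨hx, hxb⟩), inf_of_le_left hxb, sub_zero]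
      · rw [inf_of_le_right hxb, hb]
        rcases hxb.eq_or_lt with h | h
        · subst h
          simp [hab, hb]
        · rw [indicator_of_notMem (by simp [h]), sub_zero]
  refine ⟨hloc, fun c d => ?_⟩
  rw [← key c, ← key d, integral_interval_sub_left (hi _ _) (hi _ _)]

end IsPrimitive

lemma LocL2.locallyIntegrable_sq {Q : ℝ → ℝ} (hQ : LocL2 Q) :
    LocallyIntegrable fun x => Q x ^ 2 :=
  locallyIntegrable_iff.2 fun K hK => by
    obtain ⟨R, hR⟩ := hK.isBounded.subset_closedBall 0
    rw [Real.closedBall_eq_Icc] at hR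
    exact (hQ.2 _ _).mono_set hR

lemma LocL2.locallyIntegrable {Q : ℝ → ℝ} (hQ : LocL2 Q) : LocallyIntegrable Q := by
  refine LocallyIntegrable.mono (f := fun x => 1 + Q x ^ 2)
    (continuous_const.locallyIntegrable.add hQ.locallyIntegrable_sq)
    hQ.1.aestronglyMeasurable (.of_forall fun x => ?_)
  rw [Real.norm_eq_abs, Real.norm_of_nonneg (by positivity), ← sq_abs]
  nlinarith [sq_nonneg (|Q x| - 1)]

/-- Smooth approximation of a compactly supported primitive of a square integrable function. -/
lemma IsPrimitive.exists_contDiff_approx {A B : ℝ} (hAB : A < B) {φ g : ℝ → ℝ}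
    (h : IsPrimitive φ g) (hφ : ∀ x ∉ Icc A B, φ x = 0) (hg : ∀ x ∉ Icc A B, g x = 0)
    (hg2 : MemLp g 2) :
    ∃ C : ℝ, 0 ≤ C ∧ ∀ s : ℝ, 0 < s → ∃ ψ : ℝ → ℝ, ContDiff ℝ (⊤ : ℕ∞) ψ ∧
      (∀ x ∉ Icc (A - 1) (B + 1), ψ x = 0) ∧
      (∀ x ∈ Icc (A - 1) (B + 1), |ψ x - φ x| ≤ C * s) ∧
      ∫ x in Icc (A - 1) (B + 1), (deriv ψ x - g x) ^ 2 ≤ C * s ^ 2 := by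
  let χ : ContDiffBump ((A + B) / 2) := ⟨(B - A) / 2, (B - A) / 2 + 1, by linarith, by linarith⟩
  have hχs : ContDiff ℝ (⊤ : ℕ∞) χ := χ.contDiff
  have hχ1 (x : ℝ) (hx : x ∈ Icc A B) : χ x = 1 := by
    apply χ.one_of_mem_closedBall
    rw [Real.closedBall_eq_Icc]
    exact ⟨by change (A + B) / 2 - (B - A) / 2 ≤ x; linarith [hx.1],
      by change x ≤ (A + B) / 2 + (B - A) / 2; linarith [hx.2]⟩
  have hχ0 (x : ℝ) (hx : x ∉ Icc (A - 1) (B + 1)) : χ x = 0 := by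
    apply χ.zero_of_le_dist
    change (B - A) / 2 + 1 ≤ _
    rw [Real.dist_eq, le_abs]
    by_contra! h'
    exact hx ⟨by linarith [h'.2], by linarith [h'.1]⟩
  have hχd (x : ℝ) (hx : x ∈ Icc A B) : deriv χ x = 0 :=
    IsLocalMax.deriv_eq_zero (.of_forall fun t => by
      rw [hχ1 x hx]
      exact χ.le_one)
  have hχdc : Continuous (deriv χ) := hχs.continuous_deriv (by simp)
  obtain ⟨K, hK⟩ := χ.hasCompactSupport.deriv.exists_bound_of_continuous hχdc
  set L : ℝ := B + 1 - (A - 1) with hL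
  have hL0 : 0 ≤ L := by linarith
  refine ⟨L + 1 + (2 + 2 * (K * (L + 1)) ^ 2 * L), by positivity, fun s hs => ?_⟩
  obtain ⟨k, -, hks, hkg⟩ := hg2.exist_eLpNorm_sub_le (by simp) (by norm_num) hs
  have hkc := hks.continuous
  set e : ℝ → ℝ := g - k with he
  have hem : MemLp e 2 := ⟨hg2.1.sub hkc.aestronglyMeasurable, hkg.trans_lt ofReal_lt_top⟩
  have hei : Integrable fun x => e x ^ 2 := hem.integrable_sq
  have hes : ∫ x, e x ^ 2 ≤ s ^ 2 := by
    rw [hem.eLpNorm_eq_integral_rpow_norm (by simp) (by simp),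
      ofReal_le_ofReal_iff hs.le] at hkg
    simp only [toReal_ofNat, Real.rpow_ofNat, Real.norm_eq_abs, sq_abs] at hkg
    rw [← one_div, ← Real.sqrt_eq_rpow] at hkg
    exact (Real.sqrt_le_left hs.le).1 hkg
  have heI : ∫ x in Icc (A - 1) (B + 1), e x ^ 2 ≤ s ^ 2 :=
    (setIntegral_le_integral hei (.of_forall fun x => sq_nonneg _)).trans hes
  have hconst (c : ℝ) : ∫ x in Icc (A - 1) (B + 1), c = c * L := by
    rw [setIntegral_const, Real.volume_real_Icc_of_le (by linarith), smul_eq_mul, mul_comm]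
  set H : ℝ → ℝ := fun x => ∫ t in (A - 1)..x, k t with hH
  have hHd (x : ℝ) : HasDerivAt H (k x) x := hkc.integral_hasStrictDerivAt _ _ |>.hasDerivAt
  have hHs : ContDiff ℝ (⊤ : ℕ∞) H := by
    rw [contDiff_infty_iff_deriv]
    exact ⟨fun x => (hHd x).differentiableAt, by rwa [funext fun x => (hHd x).deriv]⟩
  have hE (x : ℝ) (hx : x ∈ Icc (A - 1) (B + 1)) : |H x - φ x| ≤ (L + 1) * s := by
    have h1 : H x - φ x = -∫ t in (A - 1)..x, e t := by
      have : (∫ t in (A - 1)..x, e t) = (∫ t in (A - 1)..x, g t) - ∫ t in (A - 1)..x, k t :=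
        intervalIntegral.integral_sub (h.intervalIntegrable _ _) (hkc.intervalIntegrable _ _)
      rw [this, h.integral_eq, hφ (A - 1) fun h' => by linarith [h'.1]]
      simp only [hH]
      ring
    have hel : LocallyIntegrable e := h.locallyIntegrable.sub hkc.locallyIntegrable
    have h2 : ∫ t in (A - 1)..x, |e t| ≤ ∫ t in Icc (A - 1) (B + 1), |e t| := by
      rw [integral_of_le hx.1]
      exact setIntegral_mono_set (hel.integrableOn_isCompact isCompact_Icc).abs
        (.of_forall fun t => abs_nonneg _)
        (.of_forall fun t ht => ⟨ht.1.le, ht.2.trans hx.2⟩)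
    have h3 : ∫ t in Icc (A - 1) (B + 1), |e t| ≤
        ∫ t in Icc (A - 1) (B + 1), (s + e t ^ 2 / s) := by
      refine setIntegral_mono (hel.integrableOn_isCompact isCompact_Icc).abs
        ((integrableOn_const (by simp)).add (hei.integrableOn.div_const s)) fun t => ?_
      have : s * (s + e t ^ 2 / s) = s ^ 2 + |e t| ^ 2 := by
        rw [sq_abs]
        field_simp
      refine le_of_mul_le_mul_left ?_ hs
      rw [this]
      nlinarith [sq_nonneg (s - |e t|), mul_nonneg hs.le (abs_nonneg (e t))]
    have h4 : ∫ t in Icc (A - 1) (B + 1), (s + e t ^ 2 / s) ≤ s * L + s := by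
      have hsi : IntegrableOn (fun _ => s) (Icc (A - 1) (B + 1)) := integrableOn_const (by simp)
      rw [MeasureTheory.integral_add hsi (hei.integrableOn.div_const s), hconst,
        MeasureTheory.integral_div]
      have : (∫ t in Icc (A - 1) (B + 1), e t ^ 2) / s ≤ s := by
        rw [div_le_iff₀ hs]
        linarith
      linarith
    rw [h1, abs_neg]
    linarith [abs_integral_le_integral_abs (f := e) (μ := volume) hx.1]
  have hψd (x : ℝ) : deriv (fun x => χ x * H x) x = deriv χ x * H x + χ x * k x :=
    (((hχs.differentiable (by simp)) x).hasDerivAt.mul (hHd x)).deriv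
  refine ⟨fun x => χ x * H x, hχs.mul hHs, fun x hx => by simp [hχ0 x hx], fun x hx => ?_, ?_⟩
  · have h1 : χ x * H x - φ x = χ x * (H x - φ x) := by
      by_cases hx' : x ∈ Icc A B
      · rw [hχ1 x hx', one_mul, one_mul]
      · rw [hφ x hx', sub_zero, sub_zero]
    rw [h1, abs_mul, abs_of_nonneg χ.nonneg]
    calc χ x * |H x - φ x| ≤ 1 * ((L + 1) * s) :=
          mul_le_mul χ.le_one (hE x hx) (abs_nonneg _) zero_le_one
      _ ≤ _ := by
          rw [one_mul]
          exact mul_le_mul_of_nonneg_right (le_add_of_nonneg_right (by positivity)) hs.le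
  · have h1 (x : ℝ) (hx : x ∈ Icc (A - 1) (B + 1)) :
        (deriv (fun x => χ x * H x) x - g x) ^ 2 ≤
          2 * e x ^ 2 + 2 * (K * ((L + 1) * s)) ^ 2 := by
      have h2 : deriv (fun x => χ x * H x) x - g x =
          deriv χ x * (H x - φ x) + χ x * (-e x) := by
        rw [hψd, he, Pi.sub_apply]
        by_cases hx' : x ∈ Icc A B
        · rw [hχ1 x hx', hχd x hx']
          ring
        · rw [hφ x hx', hg x hx']
          ring
      have h3 : (deriv χ x * (H x - φ x)) ^ 2 ≤ (K * ((L + 1) * s)) ^ 2 := by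
        rw [← sq_abs, abs_mul]
        have := hK x
        rw [Real.norm_eq_abs] at this
        exact pow_le_pow_left₀ (by positivity) (mul_le_mul this (hE x hx) (abs_nonneg _)
          ((abs_nonneg _).trans this)) 2
      have h4 : (χ x * (-e x)) ^ 2 ≤ e x ^ 2 := by
        rw [mul_pow, neg_sq]
        exact mul_le_of_le_one_left (sq_nonneg _) (pow_le_one₀ χ.nonneg χ.le_one)
      rw [h2]
      nlinarith [sq_nonneg (deriv χ x * (H x - φ x) - χ x * (-e x))]
    have hi : IntegrableOn (fun x => 2 * e x ^ 2 + 2 * (K * ((L + 1) * s)) ^ 2)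
        (Icc (A - 1) (B + 1)) := (hei.const_mul 2).integrableOn.add (integrableOn_const (by simp))
    calc ∫ x in Icc (A - 1) (B + 1), (deriv (fun x => χ x * H x) x - g x) ^ 2
        ≤ ∫ x in Icc (A - 1) (B + 1), (2 * e x ^ 2 + 2 * (K * ((L + 1) * s)) ^ 2) :=
          integral_mono_of_nonneg (.of_forall fun x => sq_nonneg _) hi
            ((ae_restrict_iff' measurableSet_Icc).2 (.of_forall h1))
      _ = 2 * (∫ x in Icc (A - 1) (B + 1), e x ^ 2) + 2 * (K * ((L + 1) * s)) ^ 2 * L := by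
          rw [MeasureTheory.integral_add (hei.const_mul 2).integrableOn
            (integrableOn_const (by simp)), hconst, MeasureTheory.integral_const_mul]
      _ ≤ 2 * s ^ 2 + 2 * (K * ((L + 1) * s)) ^ 2 * L := by linarith
      _ ≤ _ := by nlinarith [mul_nonneg (add_nonneg hL0 zero_le_one) (sq_nonneg s)]

/-- `L_q ≥ 0` extends to test functions with square integrable derivative. -/
lemma LqNonneg.integral_nonneg_of_isPrimitive {Q : ℝ → ℝ} (hpos : LqNonneg Q) (hQ : LocL2 Q)
    {A B : ℝ} (hAB : A < B) {φ g : ℝ → ℝ} (h : IsPrimitive φ g) (hφ : ∀ x ∉ Icc A B, φ x = 0)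
    (hg : ∀ x ∉ Icc A B, g x = 0) (hg2 : MemLp g 2) :
    0 ≤ ∫ x in A..B, (g x ^ 2 - 2 * (Q x * φ x * g x)) := by
  obtain ⟨C, hC, happ⟩ := h.exists_contDiff_approx hAB hφ hg hg2
  obtain ⟨M, hM⟩ := (isCompact_Icc (a := A) (b := B)).exists_bound_of_continuousOn
    h.continuous.continuousOn
  have hM0 : 0 ≤ M := (norm_nonneg _).trans (hM A ⟨le_rfl, hAB.le⟩)
  have hφM (x : ℝ) : |φ x| ≤ M := by
    by_cases hx : x ∈ Icc A B
    · exact hM x hx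
    · rwa [hφ x hx, abs_zero]
  set I := Icc (A - 1) (B + 1) with hI
  have hIc : IsCompact I := isCompact_Icc
  have hsub : Icc A B ⊆ I := Icc_subset_Icc (by linarith) (by linarith)
  have hgi : IntegrableOn (fun x => g x ^ 2) I := hg2.integrable_sq.integrableOn
  have hQi : IntegrableOn (fun x => Q x ^ 2) I := hQ.2 _ _
  have hQL : MemLp Q 2 (volume.restrict I) :=
    (memLp_two_iff_integrable_sq hQ.1.aestronglyMeasurable).2 hQi
  have hform (f f' : ℝ → ℝ) (hf : Continuous f) (hf' : MemLp f' 2 (volume.restrict I)) :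
      IntegrableOn (fun x => f' x ^ 2) I ∧ IntegrableOn (fun x => Q x * f x * f' x) I := by
    refine ⟨hf'.integrable_sq, ?_⟩
    have hi : IntegrableOn (fun x => Q x * f' x) I := hQL.integrable_mul hf'
    simpa only [mul_left_comm, mul_assoc] using hi.continuousOn_mul hf.continuousOn hIc
  obtain ⟨hg1, hg3⟩ := hform φ g h.continuous (hg2.restrict I)
  set F := ∫ x in I, (g x ^ 2 - 2 * (Q x * φ x * g x)) with hF
  have hFeq : ∫ x in A..B, (g x ^ 2 - 2 * (Q x * φ x * g x)) = F := by
    rw [integral_of_le hAB.le, ← integral_Icc_eq_integral_Ioc, hF]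
    refine (setIntegral_eq_of_subset_of_forall_sdiff_eq_zero measurableSet_Icc hsub
      fun x hx => ?_).symm
    rw [hg x hx.2]
    ring
  rw [hFeq]
  set G := ∫ x in I, g x ^ 2
  set R := ∫ x in I, Q x ^ 2
  have key (s : ℝ) (hs : 0 < s) :
      0 ≤ F + s * (G + C + C * s + M * (R + C) + C * (R + G) + C * (R + C * s ^ 2)) := by
    obtain ⟨ψ, hψs, hψ0, hψφ, hψg⟩ := happ s hs
    have hψs1 : ContDiff ℝ 1 ψ := hψs.of_le (by simp)
    have hψdc : Continuous (deriv ψ) := hψs1.continuous_deriv le_rfl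
    have hψc : HasCompactSupport ψ := HasCompactSupport.intro hIc hψ0
    have hψd0 (x : ℝ) (hx : x ∉ I) : deriv ψ x = 0 := by
      have : ψ =ᶠ[nhds x] fun _ => 0 := by
        filter_upwards [hIc.isClosed.isOpen_compl.mem_nhds hx] with t ht using hψ0 t ht
      rw [this.deriv_eq, deriv_const]
    have hψL : MemLp (deriv ψ) 2 (volume.restrict I) :=
      (hψdc.memLp_of_hasCompactSupport hψc.deriv).restrict I
    obtain ⟨hψ1, hψ3⟩ := hform ψ (deriv ψ) hψs.continuous hψL
    set d : ℝ → ℝ := fun x => deriv ψ x - g x with hd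
    have hdi : IntegrableOn (fun x => d x ^ 2) I := (hψL.sub (hg2.restrict I)).integrable_sq
    have hψpos := hpos ψ hψs hψc
    rw [← setIntegral_eq_integral_of_forall_compl_eq_zero (s := I)
        (f := fun x => deriv ψ x ^ 2) (fun x hx => by rw [hψd0 x hx]; simp),
      ← setIntegral_eq_integral_of_forall_compl_eq_zero (s := I)
        (f := fun x => Q x * ψ x * deriv ψ x) (fun x hx => by rw [hψd0 x hx]; simp),
      ← MeasureTheory.integral_const_mul, ← MeasureTheory.integral_sub hψ1 (hψ3.const_mul 2)]
      at hψpos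
    have hpt (x : ℝ) (hx : x ∈ I) : deriv ψ x ^ 2 - 2 * (Q x * ψ x * deriv ψ x) ≤
        (g x ^ 2 - 2 * (Q x * φ x * g x)) + ((s + C * s) * g x ^ 2 +
          ((1 + M) / s + 1 + C * s) * d x ^ 2 + (M * s + 2 * (C * s)) * Q x ^ 2) := by
      have e1 : deriv ψ x = g x + d x := by simp [hd]
      obtain ⟨δ, hδ⟩ : ∃ δ, δ = ψ x - φ x := ⟨_, rfl⟩
      have e2 : ψ x = φ x + δ := by rw [hδ]; ring
      have e3 : |δ| ≤ C * s := hδ ▸ hψφ x hx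
      have young (a b : ℝ) : 2 * (|a| * |b|) ≤ s * a ^ 2 + b ^ 2 / s := by
        refine le_of_mul_le_mul_left ?_ hs
        have : s * (s * a ^ 2 + b ^ 2 / s) = (s * |a|) ^ 2 + |b| ^ 2 := by
          rw [mul_pow, sq_abs, sq_abs]
          field_simp
        rw [this]
        nlinarith [sq_nonneg (s * |a| - |b|)]
      have young1 (a b : ℝ) : 2 * (|a| * |b|) ≤ a ^ 2 + b ^ 2 := by
        rw [← sq_abs a, ← sq_abs b]
        nlinarith [sq_nonneg (|a| - |b|)]
      have t1 : 2 * (g x * d x) ≤ s * g x ^ 2 + d x ^ 2 / s := by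
        refine le_trans ?_ (young (g x) (d x))
        rw [← abs_mul]
        linarith [le_abs_self (g x * d x)]
      have t2 : -(2 * (Q x * φ x * d x)) ≤ M * (s * Q x ^ 2 + d x ^ 2 / s) := by
        have := mul_le_mul (hφM x) (young (Q x) (d x)) (by positivity) hM0
        refine le_trans ?_ this
        rw [← abs_mul, mul_left_comm |φ x|, ← abs_mul]
        have := neg_abs_le (φ x * (Q x * d x))
        linarith
      have t3 (c : ℝ) : -(2 * (Q x * δ * c)) ≤ C * s * (Q x ^ 2 + c ^ 2) := by
        have := mul_le_mul e3 (young1 (Q x) c) (by positivity) (by positivity)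
        refine le_trans ?_ this
        rw [← abs_mul, mul_left_comm |δ|, ← abs_mul]
        have := neg_abs_le (δ * (Q x * c))
        linarith
      have t4 := t3 (g x)
      have t5 := t3 (d x)
      rw [e1, e2]
      have e4 : ((1 + M) / s + 1 + C * s) * d x ^ 2 =
        d x ^ 2 / s + M * (d x ^ 2 / s) + d x ^ 2 + C * s * d x ^ 2 := by ring
      rw [e4]
      linarith
    have i1 : IntegrableOn (fun x => g x ^ 2 - 2 * (Q x * φ x * g x)) I :=
      hg1.sub (hg3.const_mul 2)
    have i2 : IntegrableOn (fun x => (s + C * s) * g x ^ 2) I := hgi.const_mul _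
    have i3 : IntegrableOn (fun x => ((1 + M) / s + 1 + C * s) * d x ^ 2) I := hdi.const_mul _
    have i4 : IntegrableOn (fun x => (M * s + 2 * (C * s)) * Q x ^ 2) I := hQi.const_mul _
    have hle := setIntegral_mono_on (hψ1.sub (hψ3.const_mul 2)) (i1.add ((i2.add i3).add i4))
      measurableSet_Icc hpt
    have hint := MeasureTheory.integral_add i1 ((i2.add i3).add i4)
    have hint2 := MeasureTheory.integral_add (i2.add i3) i4
    have hint3 := MeasureTheory.integral_add i2 i3
    simp only [Pi.add_apply, Pi.sub_apply, MeasureTheory.integral_const_mul] at hle hint hint2 hint3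
    have hdb : ((1 + M) / s + 1 + C * s) * ∫ x in I, d x ^ 2 ≤
        ((1 + M) / s + 1 + C * s) * (C * s ^ 2) :=
      mul_le_mul_of_nonneg_left hψg (by positivity)
    have e5 : ((1 + M) / s + 1 + C * s) * (C * s ^ 2) =
        (1 + M) * (C * s) + C * s ^ 2 + C * s * (C * s ^ 2) := by
      field_simp
    rw [e5] at hdb
    linarith
  have hlim : Tendsto (fun s : ℝ => F + s * (G + C + C * s + M * (R + C) + C * (R + G) +
      C * (R + C * s ^ 2))) (nhdsWithin 0 (Ioi 0)) (nhds F) := by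
    have hc : Continuous fun s : ℝ => F + s * (G + C + C * s + M * (R + C) + C * (R + G) +
        C * (R + C * s ^ 2)) := by fun_prop
    simpa using (hc.tendsto 0).mono_left nhdsWithin_le_nhds
  exact ge_of_tendsto hlim (by filter_upwards [self_mem_nhdsWithin] with s hs using key s hs)

/-- `(y, u)` is a locally absolutely continuous solution of `y' = Q y + u`,
`u' = -Q² y - Q u`. -/
structure IsSolution (Q y u : ℝ → ℝ) : Prop where
  fst : IsPrimitive y fun t => Q t * y t + u t
  snd : IsPrimitive u fun t => -(Q t) ^ 2 * y t - Q t * u t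

namespace IsSolution

variable {Q y u z w : ℝ → ℝ}

lemma exists_initial (hQ : LocL2 Q) (p : ℝ × ℝ) :
    ∃ y u, IsSolution Q y u ∧ y 0 = p.1 ∧ u 0 = p.2 := by
  let π₁ := ContinuousLinearMap.fst ℝ ℝ ℝ
  let π₂ := ContinuousLinearMap.snd ℝ ℝ ℝ
  let A : ℝ → ℝ × ℝ →L[ℝ] ℝ × ℝ := fun t =>
    Q t • (π₁.prod (-π₂)) + π₂.prod 0 + Q t ^ 2 • (0 : ℝ × ℝ →L[ℝ] ℝ).prod (-π₁)
  have hA : LocallyIntegrable A := by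
    refine locallyIntegrable_iff.2 fun K hK => ?_
    have h1 := (hQ.locallyIntegrable.integrableOn_isCompact hK).smul_const (π₁.prod (-π₂))
    have h2 : IntegrableOn (fun _ : ℝ => π₂.prod (0 : ℝ × ℝ →L[ℝ] ℝ)) K :=
      continuous_const.locallyIntegrable.integrableOn_isCompact hK
    have h3 := (hQ.locallyIntegrable_sq.integrableOn_isCompact hK).smul_const
      ((0 : ℝ × ℝ →L[ℝ] ℝ).prod (-π₁))
    exact (h1.add h2).add h3
  obtain ⟨Y, hYi, hYc, hY⟩ := exists_continuous_linear_integral_equation hA p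
  have hY0 : Y 0 = p := by simpa using hY 0
  have hAY (t : ℝ) : A t (Y t) =
      (Q t * (Y t).1 + (Y t).2, -(Q t) ^ 2 * (Y t).1 - Q t * (Y t).2) := by
    ext
    · simp [A, π₁, π₂]
    · simp [A, π₁, π₂]
      ring
  refine ⟨fun t => (Y t).1, fun t => (Y t).2, ⟨.of_integral_zero_eq ?_ fun x => ?_,
    .of_integral_zero_eq ?_ fun x => ?_⟩, by simp [hY0], by simp [hY0]⟩
  · exact (locallyIntegrable_mul_continuous hQ.locallyIntegrable hYc.fst).add
      hYc.snd.locallyIntegrable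
  · have h1 := π₁.intervalIntegral_comp_comm (hYi 0 x)
    have h2 := congrArg Prod.fst (hY x)
    simp only [hAY, π₁, ContinuousLinearMap.coe_fst', Prod.fst_add] at h1 h2
    rw [h2, h1, hY0]
  · exact (locallyIntegrable_mul_continuous hQ.locallyIntegrable_sq.neg hYc.fst).sub
      (locallyIntegrable_mul_continuous hQ.locallyIntegrable hYc.snd)
  · have h1 := π₂.intervalIntegral_comp_comm (hYi 0 x)
    have h2 := congrArg Prod.snd (hY x)
    simp only [hAY, π₂, ContinuousLinearMap.coe_snd', Prod.snd_add] at h1 h2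
    rw [h2, h1, hY0]

lemma solves (h : IsSolution Q y u) : Solves Q y :=
  ⟨u, h.fst.eq_add_integral 0, h.snd.eq_add_integral 0⟩

lemma linearCombination (h : IsSolution Q y u) (h' : IsSolution Q z w) (c d : ℝ) :
    IsSolution Q (fun t => c * y t + d * z t) (fun t => c * u t + d * w t) := by
  constructor
  · convert (h.fst.const_mul c).add (h'.fst.const_mul d) using 2
    ring
  · convert (h.snd.const_mul c).add (h'.snd.const_mul d) using 2
    ring

/-- The Wronskian of two solutions is constant. -/
lemma wronskian_eq (h : IsSolution Q y u) (h' : IsSolution Q z w) (x : ℝ) :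
    y x * w x - z x * u x = y 0 * w 0 - z 0 * u 0 := by
  have h1 := (h.fst.mul h'.snd).integral_eq 0 x
  have h2 := (h'.fst.mul h.snd).integral_eq 0 x
  have h3 : (∫ t in (0 : ℝ)..x,
      ((Q t * y t + u t) * w t + y t * (-(Q t) ^ 2 * z t - Q t * w t))) =
      ∫ t in (0 : ℝ)..x, ((Q t * z t + w t) * u t + z t * (-(Q t) ^ 2 * y t - Q t * u t)) := by
    congr 1
    ext t
    ring
  linarith

lemma memLp_indicator_deriv (hQ : LocL2 Q) (h : IsSolution Q y u) (a b : ℝ) :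
    MemLp ((Ioc a b).indicator fun t => Q t * y t + u t) 2 := by
  rw [memLp_indicator_iff_restrict measurableSet_Ioc]
  have hm := h.fst.locallyIntegrable.aestronglyMeasurable
  rw [memLp_two_iff_integrable_sq hm.restrict]
  have h1 : LocallyIntegrable fun t =>
      Q t ^ 2 * y t ^ 2 + Q t * (2 * y t * u t) + u t ^ 2 := by
    have hy := h.fst.continuous
    have hu := h.snd.continuous
    exact ((locallyIntegrable_mul_continuous hQ.locallyIntegrable_sq (hy.pow 2)).add
      (locallyIntegrable_mul_continuous hQ.locallyIntegrable
        ((continuous_const.mul hy).mul hu))).add (hu.pow 2).locallyIntegrable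
  refine ((h1.integrableOn_isCompact (isCompact_Icc (a := a) (b := b))).mono_set
    Ioc_subset_Icc_self).congr (.of_forall fun t => ?_)
  ring

/-- Under `L_q ≥ 0`, a solution with two zeros has vanishing Cauchy data at the second one. -/
lemma snd_eq_zero_of_two_zeros (hQ : LocL2 Q) (hpos : LqNonneg Q) (h : IsSolution Q y u)
    {α β : ℝ} (hαβ : α < β) (hα : y α = 0) (hβ : y β = 0) : u β = 0 := by
  set ψ : ℝ → ℝ := fun x => (x - α) * (β + 1 - x) with hψ
  have hψs : ContDiff ℝ 1 ψ := by fun_prop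
  have hψα : ψ α = 0 := by simp [hψ]
  have hψβ : ψ β = β - α := by simp [hψ]
  have hψe : ψ (β + 1) = 0 := by simp [hψ]
  have hψp : IsPrimitive ψ (deriv ψ) := .of_contDiff hψs
  have hψd : Continuous (deriv ψ) := hψs.continuous_deriv le_rfl
  have hyp := h.fst.indicator hαβ.le hα hβ
  have hψi := hψp.indicator (a := α) (b := β + 1) (by linarith) hψα hψe
  have hq2 : LocallyIntegrable fun x => deriv ψ x ^ 2 - Q x * (2 * ψ x * deriv ψ x) :=
    (hψd.pow 2).locallyIntegrable.sub (locallyIntegrable_mul_continuous hQ.locallyIntegrable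
      ((continuous_const.mul hψs.continuous).mul hψd))
  have hq2i (a b : ℝ) :
      IntervalIntegrable (fun x => deriv ψ x ^ 2 - Q x * (2 * ψ x * deriv ψ x)) volume a b :=
    IntegrableOn.intervalIntegrable (hq2.integrableOn_isCompact isCompact_uIcc)
  set C := (∫ x in α..β, (deriv ψ x ^ 2 - Q x * (2 * ψ x * deriv ψ x))) +
    ∫ x in β..(β + 1), (deriv ψ x ^ 2 - Q x * (2 * ψ x * deriv ψ x)) with hC
  have key (t : ℝ) : 0 ≤ C * (t * t) + 2 * (u β * ψ β) * t + 0 := by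
    have hform := hpos.integral_nonneg_of_isPrimitive hQ (A := α) (B := β + 1) (by linarith)
      (hyp.add (hψi.const_mul t))
      (fun x hx => by
        rw [indicator_of_notMem hx, indicator_of_notMem fun h' => hx ⟨h'.1, by linarith [h'.2]⟩]
        simp)
      (fun x hx => by
        rw [indicator_of_notMem fun h' => hx ⟨h'.1.le, by linarith [h'.2]⟩,
          indicator_of_notMem fun h' => hx ⟨h'.1.le, h'.2⟩]
        simp)
      ((h.memLp_indicator_deriv hQ α β).add (MemLp.const_mul (by
        rw [memLp_indicator_iff_restrict measurableSet_Ioc]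
        rw [memLp_two_iff_integrable_sq hψd.aestronglyMeasurable]
        exact ((hψd.pow 2).locallyIntegrable.integrableOn_isCompact isCompact_Icc).mono_set
          Ioc_subset_Icc_self) t))
    set F : ℝ → ℝ := fun x => ((Ioc α β).indicator (fun t => Q t * y t + u t) x +
      t * (Ioc α (β + 1)).indicator (deriv ψ) x) ^ 2 -
      2 * (Q x * ((Icc α β).indicator y x + t * (Icc α (β + 1)).indicator ψ x) *
        ((Ioc α β).indicator (fun t => Q t * y t + u t) x +
          t * (Ioc α (β + 1)).indicator (deriv ψ) x)) with hF
    have i1 := (h.fst.mul h.snd).intervalIntegrable α β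
    have i2 := (h.snd.mul hψp).intervalIntegrable α β
    have h1 : EqOn (fun x => ((Q x * y x + u x) * u x + y x * (-(Q x) ^ 2 * y x - Q x * u x)) +
        (2 * t) * ((-(Q x) ^ 2 * y x - Q x * u x) * ψ x + u x * deriv ψ x) +
        t ^ 2 * (deriv ψ x ^ 2 - Q x * (2 * ψ x * deriv ψ x))) F (uIoc α β) := by
      intro x hx
      rw [uIoc_of_le hαβ.le] at hx
      have hx2 : x ∈ Ioc α (β + 1) := ⟨hx.1, by linarith [hx.2]⟩
      simp only [hF, indicator_of_mem hx, indicator_of_mem hx2,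
        indicator_of_mem (Ioc_subset_Icc_self hx), indicator_of_mem (Ioc_subset_Icc_self hx2)]
      ring
    have h2 : EqOn (fun x => t ^ 2 * (deriv ψ x ^ 2 - Q x * (2 * ψ x * deriv ψ x))) F
        (uIoc β (β + 1)) := by
      intro x hx
      rw [uIoc_of_le (by linarith)] at hx
      have hx1 : x ∉ Icc α β := fun h' => absurd h'.2 (not_le.2 hx.1)
      have hx2 : x ∈ Ioc α (β + 1) := ⟨hαβ.trans hx.1, hx.2⟩
      simp only [hF, indicator_of_notMem hx1, indicator_of_mem hx2,
        indicator_of_notMem fun h' => hx1 (Ioc_subset_Icc_self h'),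
        indicator_of_mem (Ioc_subset_Icc_self hx2)]
      ring
    have j1 := (i1.add (i2.const_mul (2 * t))).add ((hq2i α β).const_mul (t ^ 2))
    have j2 := (hq2i β (β + 1)).const_mul (t ^ 2)
    have e1 : ∫ x in α..β, F x = 2 * t * (u β * ψ β) +
        t ^ 2 * ∫ x in α..β, (deriv ψ x ^ 2 - Q x * (2 * ψ x * deriv ψ x)) := by
      rw [← intervalIntegral.integral_congr_ae (.of_forall fun x hx => h1 hx),
        intervalIntegral.integral_add (i1.add (i2.const_mul (2 * t)))
          ((hq2i α β).const_mul (t ^ 2)),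
        intervalIntegral.integral_add i1 (i2.const_mul (2 * t)),
        intervalIntegral.integral_const_mul, intervalIntegral.integral_const_mul,
        (h.fst.mul h.snd).integral_eq, (h.snd.mul hψp).integral_eq, hα, hβ, hψα]
      ring
    have e2 : ∫ x in β..(β + 1), F x =
        t ^ 2 * ∫ x in β..(β + 1), (deriv ψ x ^ 2 - Q x * (2 * ψ x * deriv ψ x)) := by
      rw [← intervalIntegral.integral_congr_ae (.of_forall fun x hx => h2 hx),
        intervalIntegral.integral_const_mul]
    have e3 := integral_add_adjacent_intervals (μ := volume) (f := F)
      (IntervalIntegrable.congr h1 j1) (IntervalIntegrable.congr h2 j2)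
    rw [← e3, e1, e2] at hform
    rw [hC]
    linarith
  have hd := discrim_le_zero key
  rw [discrim, hψβ] at hd
  have h0 : u β * (β - α) = 0 := by nlinarith [sq_nonneg (u β * (β - α))]
  exact (mul_eq_zero.1 h0).resolve_right (by linarith)

/-- Under `L_q ≥ 0`, a nontrivial combination of two solutions with unit Wronskian has at most
one zero. -/
lemma eq_zero_of_two_zeros (hQ : LocL2 Q) (hpos : LqNonneg Q) (h : IsSolution Q y u)
    (h' : IsSolution Q z w) (hW : ∀ x, y x * w x - z x * u x = 1) {c d α β : ℝ} (hαβ : α < β)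
    (hα : c * y α + d * z α = 0) (hβ : c * y β + d * z β = 0) : c = 0 ∧ d = 0 := by
  have h1 : c * u β + d * w β = 0 :=
    (h.linearCombination h' c d).snd_eq_zero_of_two_zeros hQ hpos hαβ hα hβ
  constructor
  · linear_combination (-c) * hW β + w β * hβ - z β * h1
  · linear_combination (-d) * hW β + y β * h1 - u β * hβ

end IsSolution

/-- A continuous function without zeros on an order-connected set keeps its sign there. -/
lemma pos_of_continuous_of_ne_zero {f : ℝ → ℝ} (hf : Continuous f) {s : Set ℝ}
    (hs : s.OrdConnected) (h0 : ∀ x ∈ s, f x ≠ 0) {a x : ℝ} (ha : a ∈ s) (hx : x ∈ s)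
    (hfa : 0 < f a) : 0 < f x := by
  by_contra hneg
  obtain ⟨t, ht, hft⟩ := hs.isPreconnected.intermediate_value hx ha hf.continuousOn
    ⟨not_lt.1 hneg, hfa.le⟩
  exact h0 t ht hft

/-- **Proposition (existence of a positive solution).** If `Q ∈ L²_loc(ℝ)`, `q = Q'`, and
`L_q ≥ 0`, then `L_q y = 0` has a strictly positive solution on `ℝ` (system sense). -/
theorem exists_positive_solution (Q : ℝ → ℝ) (hQ : LocL2 Q) (hpos : LqNonneg Q) :
    ∃ y : ℝ → ℝ, Solves Q y ∧ ∀ x : ℝ, 0 < y x := by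
  obtain ⟨y, u, h, hy0, hu0⟩ := IsSolution.exists_initial hQ (1, 0)
  obtain ⟨z, w, h', hz0, hw0⟩ := IsSolution.exists_initial hQ (0, 1)
  have hW (x : ℝ) : y x * w x - z x * u x = 1 := by
    rw [h.wronskian_eq h' x, hy0, hu0, hz0, hw0]
    norm_num
  have hyc := h.fst.continuous
  have hzc := h'.fst.continuous
  have hne (a : ℝ) (hya : y a = 0) (hza : z a = 0) : False := by
    have := hW a
    simp [hya, hza] at this
  let K : ℕ → Set (ℝ × ℝ) := fun n =>
    Metric.sphere 0 1 ∩ {p | ∀ x ∈ Icc (-(n : ℝ)) n, 0 ≤ p.1 * y x + p.2 * z x}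
  have hKclosed (n : ℕ) : IsClosed (K n) := by
    refine Metric.isClosed_sphere.inter ?_
    simp only [ofPred_forall]
    exact isClosed_iInter fun x => isClosed_iInter fun _ =>
      isClosed_le continuous_const (by fun_prop)
  have hKne (n : ℕ) : (K n).Nonempty := by
    set a : ℝ := -(n : ℝ) - 1 with ha
    have hnz (x : ℝ) (hx : a < x) : z a * y x + -y a * z x ≠ 0 := by
      intro hzero
      obtain ⟨h1, h2⟩ := h.eq_zero_of_two_zeros hQ hpos h' hW hx (by ring) hzero
      exact hne a (neg_eq_zero.1 h2) h1
    obtain ⟨σ, hσ, hσpos⟩ : ∃ σ : ℝ, σ ≠ 0 ∧ 0 < σ * (z a * y 0 + -y a * z 0) := by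
      have h0 := hnz 0 (by rw [ha]; linarith [n.cast_nonneg (α := ℝ)])
      exact ⟨_, h0, mul_self_pos.2 h0⟩
    set p : ℝ × ℝ := (σ * z a, -(σ * y a)) with hp
    have hp0 : p ≠ 0 := by
      intro h0
      rw [hp, Prod.mk_eq_zero, neg_eq_zero] at h0
      exact hne a ((mul_eq_zero.1 h0.2).resolve_left hσ) ((mul_eq_zero.1 h0.1).resolve_left hσ)
    refine ⟨‖p‖⁻¹ • p, ?_, fun x hx => ?_⟩
    · rw [mem_sphere_zero_iff_norm, norm_smul, norm_inv, norm_norm,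
        inv_mul_cancel₀ (norm_ne_zero_iff.2 hp0)]
    · have h1 : 0 < p.1 * y x + p.2 * z x := by
        refine pos_of_continuous_of_ne_zero (f := fun x => p.1 * y x + p.2 * z x)
          (by fun_prop) (ordConnected_Ioi (a := a)) (fun t ht => ?_)
          (a := 0) ?_ ?_ ?_
        · rw [hp]
          convert mul_ne_zero hσ (hnz t ht) using 1
          ring
        · rw [mem_Ioi, ha]
          linarith [n.cast_nonneg (α := ℝ)]
        · rw [mem_Ioi, ha]
          linarith [hx.1]
        · rw [hp]
          convert hσpos using 1
          ring
      change 0 ≤ (‖p‖⁻¹ * p.1) * y x + (‖p‖⁻¹ * p.2) * z x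
      linarith [mul_nonneg (inv_nonneg.2 (norm_nonneg p)) h1.le]
  obtain ⟨⟨c, d⟩, hcd⟩ := IsCompact.nonempty_iInter_of_sequence_nonempty_isCompact_isClosed K
    (fun n p hp => ⟨hp.1, fun x hx => hp.2 x ⟨by push_cast; linarith [hx.1],
      by push_cast; linarith [hx.2]⟩⟩) hKne
    ((isCompact_sphere 0 1).of_isClosed_subset (hKclosed 0) inter_subset_left) hKclosed
  rw [mem_iInter] at hcd
  have hcd0 : ¬(c = 0 ∧ d = 0) := by
    rintro ⟨rfl, rfl⟩
    simpa using (hcd 0).1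
  have hnonneg (x : ℝ) : 0 ≤ c * y x + d * z x := by
    obtain ⟨n, hn⟩ := exists_nat_ge |x|
    exact (hcd n).2 x (abs_le.1 hn)
  refine ⟨_, (h.linearCombination h' c d).solves, fun x => (hnonneg x).lt_of_ne' fun hx => ?_⟩
  have hposne (t : ℝ) (ht : t ≠ x) : 0 < c * y t + d * z t := by
    refine (hnonneg t).lt_of_ne' fun h0 => hcd0 ?_
    rcases ht.lt_or_gt with ht | ht
    · exact h.eq_zero_of_two_zeros hQ hpos h' hW ht h0 hx
    · exact h.eq_zero_of_two_zeros hQ hpos h' hW ht hx h0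
  -- Perturb by a solution that is negative at the zero `x`: this creates two zeros.
  let f : ℝ → ℝ → ℝ := fun ε t => (c - ε * y x) * y t + (d - ε * z x) * z t
  have hfc (ε : ℝ) : Continuous (f ε) := by fun_prop
  have hev (t : ℝ) (ht : t ≠ x) : ∀ᶠ ε in nhdsWithin (0 : ℝ) (Ioi 0), 0 < f ε t := by
    have hc : Continuous fun ε => f ε t := by fun_prop
    refine ((hc.tendsto 0).eventually (lt_mem_nhds ?_)).filter_mono nhdsWithin_le_nhds
    simpa [f] using hposne t ht
  obtain ⟨ε, ⟨h1, h2⟩, hε⟩ := (((hev (x - 1) (by simp)).and (hev (x + 1) (by simp))).and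
    self_mem_nhdsWithin).exists
  have h3 : f ε x < 0 := by
    have h4 : 0 < y x ^ 2 + z x ^ 2 := by
      by_contra hle
      exact hne x (by nlinarith [sq_nonneg (y x), sq_nonneg (z x)])
        (by nlinarith [sq_nonneg (y x), sq_nonneg (z x)])
    have h5 : f ε x = -(ε * (y x ^ 2 + z x ^ 2)) := by
      simp only [f]
      linear_combination hx
    rw [h5]
    exact neg_neg_of_pos (mul_pos hε h4)
  obtain ⟨s, hs, hfs⟩ := intermediate_value_Ioo' (by linarith : x - 1 ≤ x)
    (hfc ε).continuousOn ⟨h3, h1⟩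
  obtain ⟨t, ht, hft⟩ := intermediate_value_Ioo (by linarith : x ≤ x + 1)
    (hfc ε).continuousOn ⟨h3, h2⟩
  obtain ⟨h6, h7⟩ := h.eq_zero_of_two_zeros hQ hpos h' hW (hs.2.trans ht.1) hfs hft
  simp only [f, h6, h7] at h1
  simp at h1
end

section
/- Let Q ∈ L²_loc(ℝ; ℝ), q = Q', and suppose λ₀(q) > 0, i.e. there exists ε > 0 such that for every φ ∈ C_c^∞(ℝ; ℝ): ∫ φ'(x)² dx − 2∫ Q(x) φ(x) φ'(x) dx ≥ ε ∫ φ(x)² dx. Then the equation L_q y = 0 has two linearly independent solutions y₁, y₂ (in the system sense) with y₁(x) > 0 and y₂(x) > 0 for all x ∈ ℝ. -/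
open MeasureTheory Filter Set intervalIntegral ENNReal

/-- An exponential weight built from a primitive of `m ≥ 0` dominates its own integral
against `m`. -/
theorem abs_integral_mul_exp_le {m : ℝ → ℝ} (hm : ∀ a b, IntervalIntegrable m volume a b)
    (hm0 : ∀ t, 0 ≤ m t) (x : ℝ) :
    |∫ t in (0 : ℝ)..x, m t * Real.exp (2 * |∫ s in (0 : ℝ)..t, m s|)| ≤
      Real.exp (2 * |∫ s in (0 : ℝ)..x, m s|) / 2 := by
  set N : ℝ → ℝ := fun t => ∫ s in (0 : ℝ)..t, m s with hN
  have hN0 : N 0 = 0 := by simp [hN]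
  have hmono : Monotone N := by
    intro a b hab
    have h : N a + ∫ s in a..b, m s = N b := integral_add_adjacent_intervals (hm _ _) (hm _ _)
    have h' : 0 ≤ ∫ s in a..b, m s := integral_nonneg hab fun t _ => hm0 t
    linarith
  have key : ∀ s : ℝ, s * s = 1 → (∀ t ∈ uIcc 0 x, |N t| = s * N t) →
      |∫ t in (0 : ℝ)..x, m t * Real.exp (2 * |N t|)| ≤ Real.exp (2 * |N x|) / 2 := by
    intro s hs hsN
    set F : ℝ → ℝ := fun t => s * Real.exp (2 * (s * N t)) with hF
    have hFmono : Monotone F := by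
      intro a b hab
      have hN' := hmono hab
      rcases mul_self_eq_one_iff.mp hs with rfl | rfl
      · simpa [hF] using hN'
      · simpa [hF] using hN'
    have hmem := (hFmono.monotoneOn (uIcc 0 x)).intervalIntegral_deriv_mem_uIcc
    have heq : ∫ t in (0 : ℝ)..x, deriv F t =
        ∫ t in (0 : ℝ)..x, 2 * (m t * Real.exp (2 * |N t|)) := by
      apply intervalIntegral.integral_congr_ae
      filter_upwards [(hm 0 x).ae_hasDerivAt_integral] with t ht htx
      have htx' := uIoc_subset_uIcc htx
      have hd : HasDerivAt N (m t) t := ht htx' 0 left_mem_uIcc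
      rw [(((hd.const_mul s).const_mul 2).exp.const_mul s).deriv, hsN t htx']
      linear_combination (2 * m t * Real.exp (2 * (s * N t))) * hs
    rw [heq, intervalIntegral.integral_const_mul] at hmem
    have habs : |2 * ∫ t in (0 : ℝ)..x, m t * Real.exp (2 * |N t|)| ≤ |F x - F 0| := by
      have := abs_sub_left_of_mem_uIcc hmem
      simpa using this
    have hFx : |F x - F 0| ≤ Real.exp (2 * |N x|) := by
      have h1 : F x - F 0 = s * (Real.exp (2 * |N x|) - 1) := by
        rw [hsN x right_mem_uIcc]; simp only [hF, hN0]; simp; ring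
      have hs1 : |s| = 1 := by
        rcases mul_self_eq_one_iff.mp hs with rfl | rfl <;> simp
      have h2 : 1 ≤ Real.exp (2 * |N x|) := Real.one_le_exp (by positivity)
      rw [h1, abs_mul, hs1, one_mul, abs_of_nonneg (by linarith)]
      linarith
    rw [abs_mul, abs_two] at habs
    linarith
  rcases le_total 0 x with hx | hx
  · refine key 1 (by norm_num) fun t ht => ?_
    rw [uIcc_of_le hx] at ht
    rw [one_mul, abs_of_nonneg (hN0 ▸ hmono ht.1)]
  · refine key (-1) (by norm_num) fun t ht => ?_
    rw [uIcc_of_ge hx] at ht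
    rw [neg_one_mul, abs_of_nonpos (hN0 ▸ hmono ht.2)]

theorem intervalIntegrable_clm_apply {E : Type*} [NormedAddCommGroup E] [NormedSpace ℝ E]
    {A : ℝ → E →L[ℝ] E} {a b : ℝ} (hA : IntervalIntegrable A volume a b) {z : ℝ → E}
    (hz : Continuous z) : IntervalIntegrable (fun t => A t (z t)) volume a b := by
  obtain ⟨C, hC⟩ := (isCompact_uIcc (a := a) (b := b)).exists_bound_of_continuousOn hz.continuousOn
  rw [intervalIntegrable_iff] at hA ⊢
  refine (hA.norm.mul_const C).mono' ?_ ?_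
  · exact (ContinuousLinearMap.id ℝ (E →L[ℝ] E)).aestronglyMeasurable_comp₂
      hA.aestronglyMeasurable hz.aestronglyMeasurable
  · refine (ae_restrict_mem measurableSet_uIoc).mono fun t ht => ?_
    exact (A t).le_of_opNorm_le_of_le le_rfl (hC t (uIoc_subset_uIcc ht))

/-- Global existence for linear differential equations `z' = A z` with locally integrable
coefficients, in integral form. -/
theorem exists_continuous_eq_add_integral_clm {E : Type*} [NormedAddCommGroup E] [NormedSpace ℝ E]
    [CompleteSpace E] {A : ℝ → E →L[ℝ] E} (hA : ∀ a b, IntervalIntegrable A volume a b) (z₀ : E) :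
    ∃ z : ℝ → E, Continuous z ∧ ∀ x, z x = z₀ + ∫ t in (0 : ℝ)..x, A t (z t) := by
  set w : ℝ → ℝ := fun x => Real.exp (2 * |∫ s in (0 : ℝ)..x, ‖A s‖|) with hw
  have hwc : Continuous w := by
    have := continuous_primitive (fun a b => (hA a b).norm) 0
    fun_prop
  have hw1 : ∀ x, 1 ≤ w x := fun x => Real.one_le_exp (by positivity)
  have hw0 : ∀ x, 0 < w x := fun x => Real.exp_pos _
  have hprim : ∀ v : ℝ → E, Continuous v → ∀ a b,
      IntervalIntegrable (fun t => A t (w t • v t)) volume a b :=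
    fun v hv a b => intervalIntegrable_clm_apply (hA a b) (hwc.smul hv)
  have hbound : ∀ (v : ℝ → E) (C : ℝ), (∀ t, ‖v t‖ ≤ C) → ∀ x,
      ‖(w x)⁻¹ • ∫ t in (0 : ℝ)..x, A t (w t • v t)‖ ≤ C / 2 := by
    intro v C hv x
    have hC : 0 ≤ C := (norm_nonneg _).trans (hv 0)
    have h1 : ‖∫ t in (0 : ℝ)..x, A t (w t • v t)‖ ≤
        |∫ t in (0 : ℝ)..x, C * (‖A t‖ * w t)| := by
      apply intervalIntegral.norm_integral_le_abs_of_norm_le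
      · refine Eventually.of_forall fun t => ?_
        calc ‖A t (w t • v t)‖ ≤ ‖A t‖ * ‖w t • v t‖ := (A t).le_opNorm _
          _ = ‖A t‖ * (w t * ‖v t‖) := by rw [norm_smul, Real.norm_of_nonneg (hw0 t).le]
          _ ≤ ‖A t‖ * (w t * C) := by gcongr; exact hv t
          _ = C * (‖A t‖ * w t) := by ring
      · exact ((hA 0 x).norm.mul_continuousOn hwc.continuousOn).const_mul C
    rw [intervalIntegral.integral_const_mul, abs_mul, abs_of_nonneg hC] at h1
    have h2 := abs_integral_mul_exp_le (fun a b => (hA a b).norm) (fun t => norm_nonneg _) x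
    rw [norm_smul, norm_inv, Real.norm_of_nonneg (hw0 x).le, inv_mul_le_iff₀ (hw0 x)]
    calc _ ≤ _ := h1
      _ ≤ C * (w x / 2) := by gcongr
      _ = _ := by ring
  have hcont : ∀ v : ℝ → E, Continuous v →
      Continuous fun x => (w x)⁻¹ • (z₀ + ∫ t in (0 : ℝ)..x, A t (w t • v t)) := by
    intro v hv
    exact (hwc.inv₀ fun x => (hw0 x).ne').smul
      (continuous_const.add (continuous_primitive (hprim v hv) 0))
  let T : BoundedContinuousFunction ℝ E → BoundedContinuousFunction ℝ E := fun v =>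
    BoundedContinuousFunction.ofNormedAddCommGroup _ (hcont v v.continuous) (‖z₀‖ + ‖v‖ / 2) <| by
      intro x
      rw [smul_add]
      refine (norm_add_le _ _).trans (add_le_add ?_ (hbound v _ v.norm_coe_le_norm x))
      rw [norm_smul, norm_inv, Real.norm_of_nonneg (hw0 x).le]
      exact mul_le_of_le_one_left (norm_nonneg _) (inv_le_one_of_one_le₀ (hw1 x))
  have hT : ContractingWith (1 / 2) T := by
    refine ⟨by norm_num, LipschitzWith.of_dist_le_mul fun v v' => ?_⟩
    refine (BoundedContinuousFunction.dist_le (by positivity)).mpr fun x => ?_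
    have h := hbound (fun t => v t - v' t) (dist v v')
      (fun t => by rw [← dist_eq_norm]; exact BoundedContinuousFunction.dist_coe_le_dist t) x
    have heq : T v x - T v' x =
        (w x)⁻¹ • ∫ t in (0 : ℝ)..x, A t (w t • (v t - v' t)) := by
      simp only [T, BoundedContinuousFunction.coe_ofNormedAddCommGroup, smul_sub, map_sub]
      rw [intervalIntegral.integral_sub (hprim v v.continuous 0 x) (hprim v' v'.continuous 0 x),
        ← smul_sub, add_sub_add_left_eq_sub]
    rw [dist_eq_norm, heq]
    refine h.trans (le_of_eq ?_)
    simp; ring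
  obtain ⟨v, hv⟩ : ∃ v, T v = v := ⟨_, hT.fixedPoint_isFixedPt⟩
  refine ⟨fun x => w x • v x, hwc.smul v.continuous, fun x => ?_⟩
  have : v x = (w x)⁻¹ • (z₀ + ∫ t in (0 : ℝ)..x, A t (w t • v t)) := by
    conv_lhs => rw [← hv]
    rfl
  change w x • v x = _
  rw [this]
  exact smul_inv_smul₀ (hw0 x).ne' _

theorem LocL2.intervalIntegrable_sq {Q : ℝ → ℝ} (hQ : LocL2 Q) (a b : ℝ) :
    IntervalIntegrable (fun x => Q x ^ 2) volume a b :=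
  intervalIntegrable_iff.mpr ((hQ.2 (min a b) (max a b)).mono_set uIoc_subset_uIcc)

theorem LocL2.memLp {Q : ℝ → ℝ} (hQ : LocL2 Q) (a b : ℝ) :
    MemLp Q 2 (volume.restrict (Icc a b)) :=
  (memLp_two_iff_integrable_sq hQ.1.aestronglyMeasurable).mpr (hQ.2 a b)

theorem LocL2.intervalIntegrable {Q : ℝ → ℝ} (hQ : LocL2 Q) (a b : ℝ) :
    IntervalIntegrable Q volume a b := by
  have h : IntegrableOn Q (Icc (min a b) (max a b)) := (hQ.memLp _ _).integrable (by norm_num)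
  exact intervalIntegrable_iff.mpr (h.mono_set uIoc_subset_uIcc)

/-- A solution of the first-order system whose two components are continuous. -/
structure ContinuousSolution (Q y u : ℝ → ℝ) : Prop where
  continuous_fst : Continuous y
  continuous_snd : Continuous u
  solvesWith : SolvesWith Q y u

theorem LocL2.exists_continuousSolution {Q : ℝ → ℝ} (hQ : LocL2 Q) (y₀ u₀ : ℝ) :
    ∃ y u : ℝ → ℝ, ContinuousSolution Q y u ∧ y 0 = y₀ ∧ u 0 = u₀ := by
  let F := ContinuousLinearMap.fst ℝ ℝ ℝ
  let S := ContinuousLinearMap.snd ℝ ℝ ℝ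
  let A : ℝ → (ℝ × ℝ) →L[ℝ] (ℝ × ℝ) := fun t =>
    Q t • F.prod (-S) + S.prod 0 + Q t ^ 2 • (ContinuousLinearMap.prod 0 (-F))
  have hA : ∀ a b, IntervalIntegrable A volume a b := by
    intro a b
    have h1 := hQ.intervalIntegrable a b
    have h2 := hQ.intervalIntegrable_sq a b
    have h3 : IntervalIntegrable (fun _ => (S.prod 0 : (ℝ × ℝ) →L[ℝ] (ℝ × ℝ))) volume a b := intervalIntegrable_const
    rw [intervalIntegrable_iff] at *
    exact ((h1.smul_const _).add h3).add (h2.smul_const _)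
  obtain ⟨z, hz, hzA⟩ := exists_continuous_eq_add_integral_clm hA (y₀, u₀)
  have hz0 : z 0 = (y₀, u₀) := by simpa using hzA 0
  have hi : ∀ x, IntervalIntegrable (fun t => A t (z t)) volume 0 x :=
    fun x => intervalIntegrable_clm_apply (hA 0 x) hz
  refine ⟨fun x => (z x).1, fun x => (z x).2, ⟨by fun_prop, by fun_prop, fun x => ?_, fun x => ?_⟩,
    by simp [hz0], by simp [hz0]⟩
  · have h := congrArg F (hzA x)
    rw [map_add, ← F.intervalIntegral_comp_comm (hi x)] at h
    simpa [F, S, A, hz0] using h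
  · have h := congrArg S (hzA x)
    rw [map_add, ← S.intervalIntegral_comp_comm (hi x)] at h
    refine h.trans ?_
    simp only [hz0]
    congr 1
    refine intervalIntegral.integral_congr fun t _ => ?_
    simp [F, S, A]; ring

/-- Integration of a product of two functions given as primitives. -/
theorem integral_add_mul_of_primitive {F G f g : ℝ → ℝ} {a b : ℝ}
    (hf : IntervalIntegrable f volume a b) (hg : IntervalIntegrable g volume a b)
    (hF : ∀ x, F x = F a + ∫ t in a..x, f t) (hG : ∀ x, G x = G a + ∫ t in a..x, g t) :
    ∫ x in a..b, (f x * G x + F x * g x) = F b * G b - F a * G a := by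
  have hac : ∀ {F f : ℝ → ℝ}, IntervalIntegrable f volume a b →
      (∀ x, F x = F a + ∫ t in a..x, f t) → AbsolutelyContinuousOnInterval F a b := by
    intro F f hf hF
    have hc : AbsolutelyContinuousOnInterval (fun _ : ℝ => F a) a b :=
      contDiff_const.contDiffOn.absolutelyContinuousOnInterval
    have := hc.add (hf.absolutelyContinuousOnInterval_intervalIntegral left_mem_uIcc)
    rwa [show (fun _ : ℝ => F a) + (fun x => ∫ t in a..x, f t) = F from
      funext fun x => (hF x).symm] at this
  have hd : ∀ {F f : ℝ → ℝ}, IntervalIntegrable f volume a b →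
      (∀ x, F x = F a + ∫ t in a..x, f t) → ∀ᵐ x, x ∈ uIcc a b → deriv F x = f x := by
    intro F f hf hF
    filter_upwards [hf.ae_hasDerivAt_integral] with x hx hxab
    rw [show F = fun x => F a + ∫ t in a..x, f t from funext hF]
    exact ((hx hxab a left_mem_uIcc).const_add _).deriv
  rw [← (hac hf hF).integral_deriv_mul_eq_sub (hac hg hG)]
  refine intervalIntegral.integral_congr_ae ?_
  filter_upwards [hd hf hF, hd hg hG] with x h1 h2 hx
  rw [h1 (uIoc_subset_uIcc hx), h2 (uIoc_subset_uIcc hx)]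

namespace ContinuousSolution

variable {Q y u y' u' : ℝ → ℝ}

theorem intervalIntegrable_fst (h : ContinuousSolution Q y u) (hQ : LocL2 Q) (a b : ℝ) :
    IntervalIntegrable (fun t => Q t * y t + u t) volume a b :=
  ((hQ.intervalIntegrable a b).mul_continuousOn h.continuous_fst.continuousOn).add
    (h.continuous_snd.intervalIntegrable a b)

theorem intervalIntegrable_snd (h : ContinuousSolution Q y u) (hQ : LocL2 Q) (a b : ℝ) :
    IntervalIntegrable (fun t => -(Q t) ^ 2 * y t - Q t * u t) volume a b :=
  ((hQ.intervalIntegrable_sq a b).neg.mul_continuousOn h.continuous_fst.continuousOn).sub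
    ((hQ.intervalIntegrable a b).mul_continuousOn h.continuous_snd.continuousOn)

theorem fst_eq (h : ContinuousSolution Q y u) (hQ : LocL2 Q) (a b : ℝ) :
    y b = y a + ∫ t in a..b, (Q t * y t + u t) := by
  rw [h.solvesWith.1 b, h.solvesWith.1 a, add_assoc, integral_add_adjacent_intervals
    (h.intervalIntegrable_fst hQ _ _) (h.intervalIntegrable_fst hQ _ _)]

theorem snd_eq (h : ContinuousSolution Q y u) (hQ : LocL2 Q) (a b : ℝ) :
    u b = u a + ∫ t in a..b, (-(Q t) ^ 2 * y t - Q t * u t) := by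
  rw [h.solvesWith.2 b, h.solvesWith.2 a, add_assoc, integral_add_adjacent_intervals
    (h.intervalIntegrable_snd hQ _ _) (h.intervalIntegrable_snd hQ _ _)]

theorem linear_combination (h : ContinuousSolution Q y u) (h' : ContinuousSolution Q y' u')
    (hQ : LocL2 Q) (α β : ℝ) :
    ContinuousSolution Q (fun x => α * y x + β * y' x) (fun x => α * u x + β * u' x) := by
  obtain ⟨hy, hu, -, -⟩ := id h
  obtain ⟨hy', hu', -, -⟩ := id h'
  refine ⟨by fun_prop, by fun_prop, fun x => ?_, fun x => ?_⟩
  · calc α * y x + β * y' x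
        = (α * y 0 + β * y' 0) + ((∫ t in (0 : ℝ)..x, α * (Q t * y t + u t)) +
            ∫ t in (0 : ℝ)..x, β * (Q t * y' t + u' t)) := by
          rw [h.solvesWith.1 x, h'.solvesWith.1 x, intervalIntegral.integral_const_mul,
            intervalIntegral.integral_const_mul]
          ring
      _ = _ := by
          rw [← intervalIntegral.integral_add ((h.intervalIntegrable_fst hQ 0 x).const_mul α)
            ((h'.intervalIntegrable_fst hQ 0 x).const_mul β)]
          congr 1
          exact intervalIntegral.integral_congr fun t _ => by ring
  · calc α * u x + β * u' x
        = (α * u 0 + β * u' 0) + ((∫ t in (0 : ℝ)..x, α * (-(Q t) ^ 2 * y t - Q t * u t)) +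
            ∫ t in (0 : ℝ)..x, β * (-(Q t) ^ 2 * y' t - Q t * u' t)) := by
          rw [h.solvesWith.2 x, h'.solvesWith.2 x, intervalIntegral.integral_const_mul,
            intervalIntegral.integral_const_mul]
          ring
      _ = _ := by
          rw [← intervalIntegral.integral_add ((h.intervalIntegrable_snd hQ 0 x).const_mul α)
            ((h'.intervalIntegrable_snd hQ 0 x).const_mul β)]
          congr 1
          exact intervalIntegral.integral_congr fun t _ => by ring

/-- The energy of a solution over an interval is a boundary term. -/
theorem integral_energy (h : ContinuousSolution Q y u) (hQ : LocL2 Q) (a b : ℝ) :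
    ∫ t in a..b, ((Q t * y t + u t) ^ 2 - 2 * (Q t * y t * (Q t * y t + u t))) =
      y b * u b - y a * u a := by
  rw [← integral_add_mul_of_primitive (h.intervalIntegrable_fst hQ a b)
    (h.intervalIntegrable_snd hQ a b) (h.fst_eq hQ a) (h.snd_eq hQ a)]
  exact intervalIntegral.integral_congr fun t _ => by ring

theorem snd_eq_zero_of_fst_eq_zero (h : ContinuousSolution Q y u) (hQ : LocL2 Q) {a b : ℝ}
    (hab : a < b) (hy : ∀ x ∈ Icc a b, y x = 0) : ∀ x ∈ Icc a b, u x = 0 := by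
  have hprim : ∀ x ∈ Icc a b, ∫ t in a..x, u t = 0 := by
    intro x hx
    have h1 := h.fst_eq hQ a x
    rw [hy x hx, hy a (left_mem_Icc.mpr hab.le), zero_add] at h1
    rw [h1]
    refine intervalIntegral.integral_congr fun t ht => ?_
    rw [uIcc_of_le hx.1] at ht
    simp [hy t ⟨ht.1, ht.2.trans hx.2⟩]
  have hopen : EqOn u (fun _ => 0) (Ioo a b) := by
    intro x hx
    have hd : HasDerivAt (fun x => ∫ t in a..x, u t) (u x) x :=
      integral_hasDerivAt_right (h.continuous_snd.intervalIntegrable _ _)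
        (h.continuous_snd.stronglyMeasurableAtFilter _ _) h.continuous_snd.continuousAt
    have h0 : HasDerivAt (fun x => ∫ t in a..x, u t) 0 x :=
      (hasDerivAt_const x (0 : ℝ)).congr_of_eventuallyEq <| by
        filter_upwards [Ioo_mem_nhds hx.1 hx.2] with t ht
        exact hprim t ⟨ht.1.le, ht.2.le⟩
    exact hd.unique h0
  have hcl := hopen.closure h.continuous_snd continuous_const
  rw [closure_Ioo hab.ne] at hcl
  exact hcl

end ContinuousSolution

theorem tendsto_integral_mul_of_tendsto_eLpNorm {α : Type*} {m : MeasurableSpace α}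
    {μ : Measure α} {f g : ℕ → α → ℝ} {F G : α → ℝ}
    (hf : ∀ n, MemLp (f n) 2 μ) (hF : MemLp F 2 μ)
    (hg : ∀ n, MemLp (g n) 2 μ) (hG : MemLp G 2 μ)
    (hfF : Tendsto (fun n => eLpNorm (f n - F) 2 μ) atTop (nhds 0))
    (hgG : Tendsto (fun n => eLpNorm (g n - G) 2 μ) atTop (nhds 0)) :
    Tendsto (fun n => ∫ x, f n x * g n x ∂μ) atTop (nhds (∫ x, F x * G x ∂μ)) := by
  have h := ((Lp.tendsto_Lp_iff_tendsto_eLpNorm'' f hf F hF).mpr hfF).inner (𝕜 := ℝ)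
    ((Lp.tendsto_Lp_iff_tendsto_eLpNorm'' g hg G hG).mpr hgG)
  have key : ∀ {p q : α → ℝ} (hp : MemLp p 2 μ) (hq : MemLp q 2 μ),
      inner ℝ (hp.toLp p) (hq.toLp q) = ∫ x, p x * q x ∂μ := by
    intro p q hp hq
    rw [L2.inner_def]
    refine integral_congr_ae ?_
    filter_upwards [hp.coeFn_toLp, hq.coeFn_toLp] with x h1 h2
    simp [h1, h2, mul_comm]
  simpa only [key] using h

theorem MeasureTheory.MemLp.mul_continuousOn_Icc {P w : ℝ → ℝ} {A B : ℝ}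
    (hP : MemLp P 2 (volume.restrict (Icc A B))) (hw : Continuous w) :
    MemLp (fun x => P x * w x) 2 (volume.restrict (Icc A B)) := by
  obtain ⟨C, hC⟩ := (isCompact_Icc (a := A) (b := B)).exists_bound_of_continuousOn hw.continuousOn
  refine hP.of_le_mul (c := C) (hP.1.mul hw.aestronglyMeasurable) ?_
  refine (ae_restrict_mem measurableSet_Icc).mono fun x hx => ?_
  rw [norm_mul, mul_comm]
  gcongr
  exact hC x hx

theorem tendsto_eLpNorm_mul_sub_of_abs_sub_le {P w : ℝ → ℝ} {φ : ℕ → ℝ → ℝ} {d : ℕ → ℝ} {A B : ℝ}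
    (hP : MemLp P 2 (volume.restrict (Icc A B)))
    (hd : ∀ n, ∀ x ∈ Icc A B, |φ n x - w x| ≤ d n) (hd0 : Tendsto d atTop (nhds 0)) :
    Tendsto (fun n => eLpNorm ((fun x => P x * φ n x) - fun x => P x * w x) 2
      (volume.restrict (Icc A B))) atTop (nhds 0) := by
  have hlim : Tendsto (fun n => ENNReal.ofReal (d n) * eLpNorm P 2 (volume.restrict (Icc A B)))
      atTop (nhds 0) := by
    have := ENNReal.Tendsto.mul_const (ENNReal.tendsto_ofReal hd0)
      (Or.inr hP.2.ne : ENNReal.ofReal 0 ≠ 0 ∨ eLpNorm P 2 (volume.restrict (Icc A B)) ≠ ∞)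
    simpa using this
  refine tendsto_of_tendsto_of_tendsto_of_le_of_le tendsto_const_nhds hlim
    (fun _ => zero_le) fun n => ?_
  refine eLpNorm_le_mul_eLpNorm_of_ae_le_mul ?_ 2
  refine (ae_restrict_mem measurableSet_Icc).mono fun x hx => ?_
  rw [Pi.sub_apply, ← mul_sub, norm_mul, mul_comm]
  gcongr
  exact hd n x hx

/-- A quadratic form inequality for test functions extends to compactly supported absolutely
continuous functions with square integrable derivative. -/
theorem LocL2.le_form_of_forall_contDiff {Q : ℝ → ℝ} (hQ : LocL2 Q) {ε : ℝ}
    (hpos : ∀ φ : ℝ → ℝ, ContDiff ℝ (⊤ : ℕ∞) φ → HasCompactSupport φ →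
      ε * (∫ x : ℝ, φ x ^ 2) ≤
        (∫ x : ℝ, deriv φ x ^ 2) - 2 * ∫ x : ℝ, Q x * φ x * deriv φ x)
    {a b : ℝ} (hab : a < b) {D w : ℝ → ℝ} (hD : MemLp D 2 volume)
    (hD0 : ∀ x ∉ Ioc a b, D x = 0) (hDint : ∫ x, D x = 0) (hw : ∀ x, w x = ∫ t in a..x, D t) :
    ε * (∫ x in Icc a b, w x ^ 2) ≤
      (∫ x in Icc a b, D x ^ 2) - 2 * ∫ x in Icc a b, Q x * w x * D x := by
  let χ : ContDiffBump ((a + b) / 2) := ⟨(b - a) / 2, (b - a) / 2 + 1, by linarith, by linarith⟩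
  set A : ℝ := a - 1 with hA
  set B : ℝ := b + 1 with hB
  set μ := volume.restrict (Icc A B) with hμ
  have hχ1 : ∀ x ∈ Icc a b, χ x = 1 := by
    intro x hx
    refine χ.one_of_mem_closedBall ?_
    rw [Real.closedBall_eq_Icc]
    constructor <;> simp only [χ] <;> linarith [hx.1, hx.2]
  have hχ0 : ∀ x ∉ Ioc A B, χ x = 0 := by
    intro x hx
    refine χ.zero_of_le_dist ?_
    by_contra hlt
    refine hx ?_
    rw [Real.dist_eq, not_le, abs_lt] at hlt
    simp only [χ] at hlt
    constructor <;> linarith [hlt.1, hlt.2]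
  have hχc : Continuous χ := χ.continuous
  have hχD : ∀ x, χ x * D x = D x := by
    intro x
    by_cases hx : x ∈ Ioc a b
    · rw [hχ1 x (Ioc_subset_Icc_self hx), one_mul]
    · rw [hD0 x hx, mul_zero]
  have hsub : Ioc a b ⊆ Ioc A B := Ioc_subset_Ioc (by linarith) (by linarith)
  have hcompl : ∀ x ∉ Icc A B, x ∉ Ioc A B := fun x hx hx' => hx (Ioc_subset_Icc_self hx')
  have hDA : ∀ x ∉ Ioc A B, D x = 0 := fun x hx => hD0 x fun hx' => hx (hsub hx')
  have hDloc : ∀ p q, IntervalIntegrable D volume p q := fun p q =>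
    (hD.locallyIntegrable (by norm_num)).integrableOn_isCompact isCompact_uIcc |>.intervalIntegrable
  have hwA : ∀ x, w x = ∫ t in A..x, D t := by
    intro x
    have h0 : ∫ t in A..a, D t = 0 := by
      refine intervalIntegral.integral_zero_ae (Eventually.of_forall fun t ht => hD0 t fun ht' => ?_)
      rw [uIoc_of_le (by linarith)] at ht
      exact absurd ht.2 (not_le.mpr ht'.1)
    rw [hw x, ← integral_add_adjacent_intervals (hDloc A a) (hDloc a x), h0, zero_add]
  have hwc : Continuous w := by
    rw [show w = fun x => ∫ t in a..x, D t from funext hw]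
    exact continuous_primitive hDloc a
  have hχint : 0 < ∫ x, χ x := χ.integral_pos
  have hone : MemLp (fun _ : ℝ => (1 : ℝ)) 2 μ := memLp_const 1
  have hmem : ∀ {f : ℝ → ℝ}, Continuous f → MemLp f 2 μ := fun hf => by
    simpa using hone.mul_continuousOn_Icc hf
  have hDμ : MemLp D 2 μ := hD.restrict _
  have hχμ : MemLp χ 2 μ := hmem hχc
  have hex : ∀ n : ℕ, ∃ g : ℝ → ℝ, HasCompactSupport g ∧ ContDiff ℝ (⊤ : ℕ∞) g ∧
      eLpNorm (D - g) 2 volume ≤ ENNReal.ofReal (1 / ((n : ℝ) + 1)) := fun n =>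
    hD.exist_eLpNorm_sub_le (by norm_num) (by norm_num) (by positivity)
  choose g _ hgs hgD using hex
  have hg : Tendsto (fun n => eLpNorm (g n - D) 2 μ) atTop (nhds 0) := by
    have hlim : Tendsto (fun n : ℕ => ENNReal.ofReal (1 / ((n : ℝ) + 1))) atTop (nhds 0) := by
      simpa using ENNReal.tendsto_ofReal (tendsto_one_div_add_atTop_nhds_zero_nat (𝕜 := ℝ))
    refine tendsto_of_tendsto_of_tendsto_of_le_of_le tendsto_const_nhds hlim
      (fun _ => zero_le) fun n => ?_
    rw [eLpNorm_sub_comm]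
    exact (eLpNorm_mono_measure _ Measure.restrict_le_self).trans (hgD n)
  have hgμ : ∀ n, MemLp (g n) 2 μ := fun n => hmem (hgs n).continuous
  set κ : ℕ → ℝ := fun n => (∫ x, χ x * g n x ∂μ) / ∫ x, χ x with hκ
  have hκ0 : Tendsto κ atTop (nhds 0) := by
    have h := tendsto_integral_mul_of_tendsto_eLpNorm (fun _ => hχμ) hχμ hgμ hDμ (by simp) hg
    have hz : ∫ x, χ x * D x ∂μ = 0 := by
      simp only [hχD]
      rw [hμ, setIntegral_eq_integral_of_forall_compl_eq_zero fun x hx => hDA x (hcompl x hx), hDint]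
    rw [hz] at h
    simpa using h.div_const (∫ x, χ x)
  set E : ℕ → ℝ → ℝ := fun n x => χ x * (g n x - κ n) with hE
  have hEs : ∀ n, ContDiff ℝ (⊤ : ℕ∞) (E n) := fun n =>
    χ.contDiff.mul ((hgs n).sub contDiff_const)
  have hE0 : ∀ n, ∀ x ∉ Ioc A B, E n x = 0 := fun n x hx => by simp [hE, hχ0 x hx]
  have hEc : ∀ n, Continuous (E n) := fun n => (hEs n).continuous
  have hEμ : ∀ n, MemLp (E n) 2 μ := fun n => hmem (hEc n)
  have hEint : ∀ n, ∫ x, E n x = 0 := by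
    intro n
    rw [← setIntegral_eq_integral_of_forall_compl_eq_zero fun x hx => hE0 n x (hcompl x hx), ← hμ]
    have h1 : Integrable (fun x => χ x * g n x) μ := hχμ.integrable_mul (hgμ n)
    have h2 : Integrable χ μ := hχμ.integrable (by norm_num)
    simp only [hE, mul_sub]
    rw [integral_sub h1 (h2.mul_const _), MeasureTheory.integral_mul_const]
    have h3 : ∫ x, χ x ∂μ = ∫ x, χ x :=
      setIntegral_eq_integral_of_forall_compl_eq_zero fun x hx => hχ0 x (hcompl x hx)
    rw [h3, hκ]
    field_simp
    ring
  have hED : Tendsto (fun n => eLpNorm (E n - D) 2 μ) atTop (nhds 0) := by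
    have hlim : Tendsto (fun n => eLpNorm (g n - D) 2 μ + ‖κ n‖ₑ * eLpNorm χ 2 μ)
        atTop (nhds 0) := by
      have h1 : Tendsto (fun n => ‖κ n‖ₑ) atTop (nhds 0) := by
        simpa using hκ0.enorm
      have h2 := ENNReal.Tendsto.mul_const h1
        (Or.inr hχμ.2.ne : (0 : ℝ≥0∞) ≠ 0 ∨ eLpNorm χ 2 μ ≠ ∞)
      simpa using hg.add h2
    refine tendsto_of_tendsto_of_tendsto_of_le_of_le tendsto_const_nhds hlim
      (fun _ => zero_le) fun n => ?_
    have heq : E n - D = (fun x => χ x * (g n x - D x)) - κ n • (χ : ℝ → ℝ) := by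
      ext x
      simp only [Pi.sub_apply, Pi.smul_apply, smul_eq_mul, hE]
      linear_combination hχD x
    rw [heq]
    refine (eLpNorm_sub_le (hχμ.1.mul ((hgμ n).1.sub hDμ.1)) (hχμ.1.const_smul _)
      (by norm_num)).trans (add_le_add ?_ (eLpNorm_const_smul _ _ _ _).le)
    refine eLpNorm_mono fun x => ?_
    rw [Pi.mul_apply, norm_mul]
    refine mul_le_of_le_one_left (norm_nonneg _) ?_
    rw [Real.norm_of_nonneg χ.nonneg]
    exact χ.le_one
  set φ : ℕ → ℝ → ℝ := fun n x => ∫ t in A..x, E n t with hφ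
  have hφd : ∀ n x, HasDerivAt (φ n) (E n x) x := fun n x =>
    integral_hasDerivAt_right ((hEc n).intervalIntegrable _ _)
      ((hEc n).stronglyMeasurableAtFilter _ _) (hEc n).continuousAt
  have hφderiv : ∀ n, deriv (φ n) = E n := fun n => funext fun x => (hφd n x).deriv
  have hφs : ∀ n, ContDiff ℝ (⊤ : ℕ∞) (φ n) := fun n =>
    contDiff_infty_iff_deriv.mpr ⟨fun x => (hφd n x).differentiableAt, hφderiv n ▸ hEs n⟩
  have hφ0 : ∀ n, ∀ x ∉ Icc A B, φ n x = 0 := by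
    intro n x hx
    rcases lt_or_ge x A with hxA | hxA
    · refine intervalIntegral.integral_zero_ae (Eventually.of_forall fun t ht => hE0 n t fun ht' => ?_)
      rw [uIoc_of_ge hxA.le] at ht
      exact absurd ht.2 (not_le.mpr ht'.1)
    · have hxB : B < x := by
        by_contra h
        exact hx ⟨hxA, not_lt.mp h⟩
      rw [hφ, ← hEint n]
      refine integral_eq_integral_of_support_subset fun t ht => ?_
      have : t ∈ Ioc A B := by
        by_contra h
        exact ht (hE0 n t h)
      exact ⟨this.1, this.2.trans hxB.le⟩
  have hφcs : ∀ n, HasCompactSupport (φ n) := fun n =>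
    HasCompactSupport.intro isCompact_Icc (hφ0 n)
  set d : ℕ → ℝ := fun n => ∫ x, ‖E n x - D x‖ * 1 ∂μ with hd
  have hd0 : Tendsto d atTop (nhds 0) := by
    have h := tendsto_integral_mul_of_tendsto_eLpNorm (fun n => ((hEμ n).sub hDμ).norm)
      (MemLp.zero (p := 2) (μ := μ) (ε := ℝ)) (fun _ => hone) hone
      (by simpa only [sub_zero, eLpNorm_norm] using hED) (by simp)
    simpa [hd] using h
  have hφw : ∀ n, ∀ x ∈ Icc A B, |φ n x - w x| ≤ d n := by
    intro n x hx
    rw [hwA x, hφ, ← intervalIntegral.integral_sub ((hEc n).intervalIntegrable _ _) (hDloc _ _),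
      ← Real.norm_eq_abs]
    refine (intervalIntegral.norm_integral_le_integral_norm hx.1).trans ?_
    rw [intervalIntegral.integral_of_le hx.1]
    simp only [hd, mul_one]
    exact setIntegral_mono_set (((hEμ n).sub hDμ).norm.integrable (by norm_num))
      (Eventually.of_forall fun t => norm_nonneg _)
      (Eventually.of_forall fun t ht => ⟨ht.1.le, ht.2.trans hx.2⟩)
  have hφc : ∀ n, Continuous (φ n) := fun n => (hφs n).continuous
  have hQμ : MemLp Q 2 μ := hQ.memLp A B
  have l1 := tendsto_integral_mul_of_tendsto_eLpNorm hEμ hDμ hEμ hDμ hED hED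
  have hφL := tendsto_eLpNorm_mul_sub_of_abs_sub_le hone hφw hd0
  have l2 := tendsto_integral_mul_of_tendsto_eLpNorm (fun n => hone.mul_continuousOn_Icc (hφc n))
    (hone.mul_continuousOn_Icc hwc) (fun n => hone.mul_continuousOn_Icc (hφc n))
    (hone.mul_continuousOn_Icc hwc) hφL hφL
  have l3 := tendsto_integral_mul_of_tendsto_eLpNorm (fun n => hQμ.mul_continuousOn_Icc (hφc n))
    (hQμ.mul_continuousOn_Icc hwc) hEμ hDμ
    (tendsto_eLpNorm_mul_sub_of_abs_sub_le hQμ hφw hd0) hED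
  have hlim := le_of_tendsto_of_tendsto' (l2.const_mul ε) (l1.sub (l3.const_mul 2)) fun n => by
    have h := hpos (φ n) (hφs n) (hφcs n)
    rw [hφderiv, ← setIntegral_eq_integral_of_forall_compl_eq_zero (s := Icc A B)
        (f := fun x => φ n x ^ 2) fun x hx => by simp [hφ0 n x hx],
      ← setIntegral_eq_integral_of_forall_compl_eq_zero (s := Icc A B)
        (f := fun x => E n x ^ 2) fun x hx => by simp [hE0 n x (hcompl x hx)],
      ← setIntegral_eq_integral_of_forall_compl_eq_zero (s := Icc A B)
        (f := fun x => Q x * φ n x * E n x) fun x hx => by simp [hE0 n x (hcompl x hx)]] at h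
    simpa only [one_mul, ← pow_two] using h
  have hw0 : ∀ x ∉ Icc a b, w x = 0 := by
    intro x hx
    rw [hw]
    rcases lt_or_ge x a with hxa | hxa
    · refine intervalIntegral.integral_zero_ae (Eventually.of_forall fun t ht => hD0 t fun ht' => ?_)
      rw [uIoc_of_ge hxa.le] at ht
      exact absurd ht.2 (not_le.mpr ht'.1)
    · have hxb : b < x := by
        by_contra h
        exact hx ⟨hxa, not_lt.mp h⟩
      rw [← hDint]
      refine integral_eq_integral_of_support_subset fun t ht => ?_
      have : t ∈ Ioc a b := by
        by_contra h
        exact ht (hD0 t h)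
      exact ⟨this.1, this.2.trans hxb.le⟩
  have hshrink : ∀ f : ℝ → ℝ, (∀ x ∉ Icc a b, f x = 0) →
      ∫ x, f x ∂μ = ∫ x in Icc a b, f x := by
    intro f hf
    rw [setIntegral_eq_integral_of_forall_compl_eq_zero hf, hμ,
      setIntegral_eq_integral_of_forall_compl_eq_zero fun x hx => hf x fun hx' =>
        hx (Icc_subset_Icc (by linarith) (by linarith) hx')]
  have hD0' : ∀ x ∉ Icc a b, D x = 0 := fun x hx => hD0 x fun hx' => hx (Ioc_subset_Icc_self hx')
  simp only [one_mul, ← pow_two] at hlim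
  rwa [hshrink (fun x => w x ^ 2) fun x hx => by simp [hw0 x hx],
    hshrink (fun x => D x ^ 2) fun x hx => by simp [hD0' x hx],
    hshrink (fun x => Q x * w x * D x) fun x hx => by simp [hD0' x hx]] at hlim

/-- The form inequality for the concatenation at `p` of two solutions vanishing at the outer
endpoints. -/
theorem ContinuousSolution.mul_integral_sq_add_le {Q f uf g ug : ℝ → ℝ}
    (hf : ContinuousSolution Q f uf) (hg : ContinuousSolution Q g ug) (hQ : LocL2 Q) {ε : ℝ}
    (hpos : ∀ φ : ℝ → ℝ, ContDiff ℝ (⊤ : ℕ∞) φ → HasCompactSupport φ →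
      ε * (∫ x : ℝ, φ x ^ 2) ≤
        (∫ x : ℝ, deriv φ x ^ 2) - 2 * ∫ x : ℝ, Q x * φ x * deriv φ x)
    {a p b : ℝ} (hap : a < p) (hpb : p < b) (hfa : f a = 0) (hgb : g b = 0) (hfg : f p = g p) :
    ε * ((∫ x in a..p, f x ^ 2) + ∫ x in p..b, g x ^ 2) ≤ f p * (uf p - ug p) := by
  have hab := hap.trans hpb
  set F : ℝ → ℝ := fun t => Q t * f t + uf t with hF
  set G : ℝ → ℝ := fun t => Q t * g t + ug t with hG
  have hmem : ∀ {y u : ℝ → ℝ}, ContinuousSolution Q y u → ∀ r s,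
      MemLp ((Ioc r s).indicator fun t => Q t * y t + u t) 2 volume := by
    intro y u h r s
    have hone : MemLp (fun _ : ℝ => (1 : ℝ)) 2 (volume.restrict (Icc r s)) := memLp_const 1
    have h1 := (hQ.memLp r s).mul_continuousOn_Icc h.continuous_fst
    have h2 := hone.mul_continuousOn_Icc h.continuous_snd
    simp only [one_mul] at h2
    exact (memLp_indicator_iff_restrict measurableSet_Ioc).mpr
      ((h1.add h2).mono_measure (Measure.restrict_mono Ioc_subset_Icc_self le_rfl))
  set D : ℝ → ℝ := fun x => (Ioc a p).indicator F x + (Ioc p b).indicator G x with hD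
  have hDm : MemLp D 2 volume := (hmem hf a p).add (hmem hg p b)
  have hDF : ∀ x ∈ Ioc a p, D x = F x := by
    intro x hx
    simp [hD, hx, not_lt.mpr hx.2]
  have hDG : ∀ x ∈ Ioc p b, D x = G x := by
    intro x hx
    simp [hD, hx, hx.1]
  have hD0 : ∀ x ∉ Ioc a b, D x = 0 := by
    intro x hx
    have h1 : x ∉ Ioc a p := fun h => hx ⟨h.1, h.2.trans hpb.le⟩
    have h2 : x ∉ Ioc p b := fun h => hx ⟨hap.trans h.1, h.2⟩
    rw [hD]
    simp only [indicator_of_notMem h1, indicator_of_notMem h2, add_zero]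
  have hDloc : ∀ r s, IntervalIntegrable D volume r s := fun r s =>
    (hDm.locallyIntegrable (by norm_num)).integrableOn_isCompact isCompact_uIcc |>.intervalIntegrable
  set w : ℝ → ℝ := fun x => ∫ t in a..x, D t with hw
  have hwf : ∀ x ∈ Icc a p, w x = f x := by
    intro x hx
    rw [hf.fst_eq hQ a x, hfa, zero_add]
    refine intervalIntegral.integral_congr_ae (Eventually.of_forall fun t ht => ?_)
    rw [uIoc_of_le hx.1] at ht
    exact hDF t ⟨ht.1, ht.2.trans hx.2⟩
  have hwg : ∀ x ∈ Icc p b, w x = g x := by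
    intro x hx
    have h1 : w p + ∫ t in p..x, D t = w x := integral_add_adjacent_intervals (hDloc _ _) (hDloc _ _)
    rw [← h1, hwf p (right_mem_Icc.mpr hap.le), hg.fst_eq hQ p x, hfg]
    congr 1
    refine intervalIntegral.integral_congr_ae (Eventually.of_forall fun t ht => ?_)
    rw [uIoc_of_le hx.1] at ht
    exact hDG t ⟨ht.1, ht.2.trans hx.2⟩
  have hDint : ∫ x, D x = 0 := by
    rw [← integral_eq_integral_of_support_subset (a := a) (b := b) (μ := volume) fun x hx => by
      by_contra h
      exact hx (hD0 x h)]
    exact (hwg b (right_mem_Icc.mpr hpb.le)).trans hgb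
  have hform := hQ.le_form_of_forall_contDiff hpos hab hDm hD0 hDint fun x => rfl
  change ε * (∫ x in Icc a b, w x ^ 2) ≤
    (∫ x in Icc a b, D x ^ 2) - 2 * ∫ x in Icc a b, Q x * w x * D x at hform
  have hwc : Continuous w := continuous_primitive hDloc a
  have hsplit : ∀ {h hl hr : ℝ → ℝ}, IntegrableOn h (Icc a b) →
      (∀ x ∈ Ioc a p, h x = hl x) → (∀ x ∈ Ioc p b, h x = hr x) →
      ∫ x in Icc a b, h x = (∫ x in a..p, hl x) + ∫ x in p..b, hr x := by
    intro h hl hr hi h1 h2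
    have hi' : ∀ {r s}, a ≤ r → r ≤ s → s ≤ b → IntervalIntegrable h volume r s := by
      intro r s har hrs hsb
      rw [intervalIntegrable_iff_integrableOn_Icc_of_le hrs]
      exact hi.mono_set (Icc_subset_Icc har hsb)
    rw [integral_Icc_eq_integral_Ioc, ← intervalIntegral.integral_of_le hab.le,
      ← integral_add_adjacent_intervals (hi' le_rfl hap.le hpb.le) (hi' hap.le hpb.le le_rfl)]
    congr 1
    · refine intervalIntegral.integral_congr_ae (Eventually.of_forall fun t ht => h1 t ?_)
      rwa [uIoc_of_le hap.le] at ht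
    · refine intervalIntegral.integral_congr_ae (Eventually.of_forall fun t ht => h2 t ?_)
      rwa [uIoc_of_le hpb.le] at ht
  have hDr : MemLp D 2 (volume.restrict (Icc a b)) := hDm.restrict _
  have hi1 : IntegrableOn (fun x => D x ^ 2) (Icc a b) := hDr.integrable_sq
  have hi2 : IntegrableOn (fun x => Q x * w x * D x) (Icc a b) :=
    ((hQ.memLp a b).mul_continuousOn_Icc hwc).integrable_mul hDr
  rw [← MeasureTheory.integral_const_mul 2, ← integral_sub hi1 (hi2.const_mul 2),
    hsplit (h := fun x => D x ^ 2 - 2 * (Q x * w x * D x))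
      (hl := fun x => F x ^ 2 - 2 * (Q x * f x * F x))
      (hr := fun x => G x ^ 2 - 2 * (Q x * g x * G x)) (hi1.sub (hi2.const_mul 2))
      (fun x hx => by rw [hDF x hx, hwf x (Ioc_subset_Icc_self hx)])
      (fun x hx => by rw [hDG x hx, hwg x (Ioc_subset_Icc_self hx)]),
    hsplit (h := fun x => w x ^ 2) (hl := fun x => f x ^ 2) (hr := fun x => g x ^ 2)
      ((hwc.pow 2).continuousOn.integrableOn_Icc)
      (fun x hx => by rw [hwf x (Ioc_subset_Icc_self hx)])
      (fun x hx => by rw [hwg x (Ioc_subset_Icc_self hx)]),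
    hf.integral_energy hQ a p, hg.integral_energy hQ p b, hfa, hgb, ← hfg] at hform
  linarith

/-- Disconjugacy: if a solution vanishes at two points, its second component vanishes between
them. -/
theorem ContinuousSolution.snd_eq_zero_of_vanish_endpoints {Q y u : ℝ → ℝ}
    (h : ContinuousSolution Q y u) (hQ : LocL2 Q) {ε : ℝ} (hε : 0 < ε)
    (hpos : ∀ φ : ℝ → ℝ, ContDiff ℝ (⊤ : ℕ∞) φ → HasCompactSupport φ →
      ε * (∫ x : ℝ, φ x ^ 2) ≤
        (∫ x : ℝ, deriv φ x ^ 2) - 2 * ∫ x : ℝ, Q x * φ x * deriv φ x)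
    {a b : ℝ} (hab : a < b) (ha : y a = 0) (hb : y b = 0) : ∀ x ∈ Icc a b, u x = 0 := by
  have hc : Continuous fun x => y x ^ 2 := h.continuous_fst.pow 2
  have hform := h.mul_integral_sq_add_le h hQ hpos (left_lt_add_div_two.mpr hab)
    (add_div_two_lt_right.mpr hab) ha hb rfl
  rw [integral_add_adjacent_intervals (hc.intervalIntegrable _ _) (hc.intervalIntegrable _ _),
    sub_self, mul_zero] at hform
  refine h.snd_eq_zero_of_fst_eq_zero hQ hab fun x hx => ?_
  by_contra hne
  have hp : 0 < ∫ x in a..b, y x ^ 2 := intervalIntegral.integral_pos hab hc.continuousOn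
    (fun x _ => sq_nonneg _) ⟨x, hx, by positivity⟩
  exact absurd hform (not_le.mpr (mul_pos hε hp))

/-- If the form is bounded below by a positive multiple of the `L²` norm, an open interval of
initial slopes produces solutions without zeros. -/
theorem LocL2.exists_forall_ne_zero {Q : ℝ → ℝ} (hQ : LocL2 Q) {ε : ℝ} (hε : 0 < ε)
    (hpos : ∀ φ : ℝ → ℝ, ContDiff ℝ (⊤ : ℕ∞) φ → HasCompactSupport φ →
      ε * (∫ x : ℝ, φ x ^ 2) ≤
        (∫ x : ℝ, deriv φ x ^ 2) - 2 * ∫ x : ℝ, Q x * φ x * deriv φ x)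
    {c uc φ uφ : ℝ → ℝ} (hc : ContinuousSolution Q c uc) (hφ : ContinuousSolution Q φ uφ)
    (hc0 : c 0 = 1) (hφ0 : φ 0 = 0) (hφne : ∀ x, x ≠ 0 → φ x ≠ 0) (huφ0 : uφ 0 = 1) :
    ∃ α β : ℝ, α < β ∧ ∀ s ∈ Ioo α β, ∀ x, c x + s * φ x ≠ 0 := by
  have hsol : ∀ s, ContinuousSolution Q (fun x => c x + s * φ x) (fun x => uc x + s * uφ x) :=
    fun s => by simpa using hc.linear_combination hφ hQ 1 s
  have hcont : ∀ s, Continuous fun x => (c x + s * φ x) ^ 2 :=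
    fun s => (hsol s).continuous_fst.pow 2
  set θ : ℝ → ℝ := fun x => -c x / φ x with hθ
  have hθ0 : ∀ x, x ≠ 0 → c x + θ x * φ x = 0 := by
    intro x hx
    have := hφne x hx
    simp only [hθ]
    field_simp
    ring
  have hgap : ∀ x < 0, ∀ x' > 0, ε * ∫ t in (0 : ℝ)..x', (c t + θ x' * φ t) ^ 2 ≤ θ x - θ x' := by
    intro x hx x' hx'
    have h := (hsol (θ x)).mul_integral_sq_add_le (hsol (θ x')) hQ hpos hx hx'
      (hθ0 x hx.ne) (hθ0 x' hx'.ne') (by simp [hφ0])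
    have hnn : 0 ≤ ∫ t in x..0, (c t + θ x * φ t) ^ 2 :=
      intervalIntegral.integral_nonneg hx.le fun t _ => sq_nonneg _
    have h' := mul_nonneg hε.le hnn
    simp only [hc0, hφ0, huφ0] at h
    linarith
  have hle : ∀ x < 0, ∀ x' > 0, θ x' ≤ θ x := by
    intro x hx x' hx'
    have hnn : 0 ≤ ∫ t in (0 : ℝ)..x', (c t + θ x' * φ t) ^ 2 :=
      intervalIntegral.integral_nonneg (le_of_lt hx') fun t _ => sq_nonneg _
    have h' := mul_nonneg hε.le hnn
    linarith [hgap x hx x' hx']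
  set A := sSup (θ '' Ioi 0) with hA
  have hbdd : BddAbove (θ '' Ioi 0) := by
    refine ⟨θ (-1), ?_⟩
    rintro _ ⟨x', hx', rfl⟩
    exact hle (-1) (by norm_num) x' hx'
  have hleA : ∀ x' > 0, θ x' ≤ A := fun x' hx' => le_csSup hbdd ⟨x', hx', rfl⟩
  set K := |A| + 1 with hK
  obtain ⟨η, hη, hηK⟩ : ∃ η > 0, ∀ t ∈ Icc 0 η, 1 / 2 < c t - K * |φ t| := by
    have hcK : Continuous fun t => c t - K * |φ t| :=
      hc.continuous_fst.sub (continuous_const.mul hφ.continuous_fst.abs)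
    have h0 : ∀ᶠ t in nhds 0, 1 / 2 < c t - K * |φ t| :=
      hcK.continuousAt.eventually (lt_mem_nhds (by norm_num [hc0, hφ0]))
    obtain ⟨η, hη, h⟩ := Metric.eventually_nhds_iff.mp h0
    refine ⟨η / 2, by positivity, fun t ht => h ?_⟩
    rw [Real.dist_eq, sub_zero, abs_of_nonneg ht.1]
    linarith [ht.2]
  have hlow : ∀ s, |s| ≤ K → ∀ t ∈ Icc 0 η, 1 / 2 < c t + s * φ t := by
    intro s hs t ht
    have h1 : |s * φ t| ≤ K * |φ t| := by rw [abs_mul]; gcongr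
    linarith [hηK t ht, neg_abs_le (s * φ t)]
  set δ := ε * (η * (1 / 4)) with hδ
  have hδ0 : 0 < δ := by positivity
  obtain ⟨_, ⟨x', hx', rfl⟩, hx'A⟩ := exists_lt_of_lt_csSup (s := θ '' Ioi 0)
    ⟨θ 1, 1, by simp, rfl⟩ (show A - min 1 (δ / 2) < A from sub_lt_self _ (by positivity))
  have hx'K : |θ x'| ≤ K := by
    have h1 := min_le_left 1 (δ / 2)
    have h2 := hleA x' hx'
    rw [abs_le]
    constructor <;> linarith [le_abs_self A, neg_abs_le A]
  have hηx' : η < x' := by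
    by_contra h
    have := hlow _ hx'K x' ⟨le_of_lt hx', not_lt.mp h⟩
    rw [hθ0 x' (ne_of_gt hx')] at this
    norm_num at this
  have hδle : δ ≤ ε * ∫ t in (0 : ℝ)..x', (c t + θ x' * φ t) ^ 2 := by
    refine mul_le_mul_of_nonneg_left ?_ hε.le
    have h1 : ∫ _ in (0 : ℝ)..η, (1 / 4 : ℝ) ≤ ∫ t in (0 : ℝ)..η, (c t + θ x' * φ t) ^ 2 := by
      refine intervalIntegral.integral_mono_on hη.le (by simp)
        ((hcont _).intervalIntegrable _ _) fun t ht => ?_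
      nlinarith [hlow _ hx'K t ht]
    have h2 : 0 ≤ ∫ t in η..x', (c t + θ x' * φ t) ^ 2 :=
      intervalIntegral.integral_nonneg hηx'.le fun t _ => sq_nonneg _
    rw [← integral_add_adjacent_intervals ((hcont _).intervalIntegrable 0 η)
      ((hcont _).intervalIntegrable η x')]
    rw [intervalIntegral.integral_const, smul_eq_mul, sub_zero] at h1
    linarith
  refine ⟨A, A + δ / 2, by linarith, fun s hs x hx => ?_⟩
  rcases eq_or_ne x 0 with rfl | hx0
  · simp [hc0, hφ0] at hx
  have hsθ : s = θ x := mul_right_cancel₀ (hφne x hx0) (by linarith [hθ0 x hx0])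
  rcases lt_or_gt_of_ne hx0 with hneg | hpos'
  · have h1 := hgap x hneg x' hx'
    have h2 := min_le_right 1 (δ / 2)
    linarith [hs.2]
  · linarith [hleA x hpos', hs.1]

/-- **Proposition (two positive solutions when `λ₀(q) > 0`).** Suppose `Q ∈ L²_loc(ℝ)`,
`q = Q'`, and `λ₀(q) > 0`, i.e. there is `ε > 0` such that
`∫ φ'² - 2 ∫ Q φ φ' ≥ ε ∫ φ²` for every test function `φ`. Then `L_q y = 0` has two linearly
independent strictly positive solutions (system sense). -/
theorem two_positive_solutions (Q : ℝ → ℝ) (hQ : LocL2 Q)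
    (hpos : ∃ ε > (0:ℝ), ∀ φ : ℝ → ℝ, ContDiff ℝ (⊤ : ℕ∞) φ → HasCompactSupport φ →
      ε * (∫ x : ℝ, φ x ^ 2) ≤
        (∫ x : ℝ, deriv φ x ^ 2) - 2 * ∫ x : ℝ, Q x * φ x * deriv φ x) :
    ∃ y₁ y₂ : ℝ → ℝ, Solves Q y₁ ∧ Solves Q y₂ ∧
      (∀ x : ℝ, 0 < y₁ x) ∧ (∀ x : ℝ, 0 < y₂ x) ∧
      LinearIndependent ℝ ![y₁, y₂] := by
  obtain ⟨ε, hε, hform⟩ := hpos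
  obtain ⟨c, uc, hc, hc0, -⟩ := hQ.exists_continuousSolution 1 0
  obtain ⟨φ, uφ, hφ, hφ0, huφ0⟩ := hQ.exists_continuousSolution 0 1
  have hφne : ∀ x, x ≠ 0 → φ x ≠ 0 := by
    intro x hx hzero
    have hu : uφ 0 = 0 := by
      rcases lt_or_gt_of_ne hx with h | h
      · exact hφ.snd_eq_zero_of_vanish_endpoints hQ hε hform h hzero hφ0 0 ⟨h.le, le_rfl⟩
      · exact hφ.snd_eq_zero_of_vanish_endpoints hQ hε hform h hφ0 hzero 0 ⟨le_rfl, le_of_lt h⟩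
    rw [huφ0] at hu
    exact one_ne_zero hu
  obtain ⟨α, β, hαβ, hne⟩ := hQ.exists_forall_ne_zero hε hform hc hφ hc0 hφ0 hφne huφ0
  obtain ⟨s, hαs, hsβ⟩ := exists_between hαβ
  obtain ⟨s', hss', hs'β⟩ := exists_between hsβ
  have hsol : ∀ s, ContinuousSolution Q (fun x => c x + s * φ x) (fun x => uc x + s * uφ x) :=
    fun s => by simpa using hc.linear_combination hφ hQ 1 s
  have hpos : ∀ s ∈ Ioo α β, ∀ x, 0 < c x + s * φ x := by
    intro s hs x
    by_contra hle
    have hmem : (0 : ℝ) ∈ uIcc (c x + s * φ x) (c 0 + s * φ 0) :=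
      mem_uIcc.mpr (Or.inl ⟨not_lt.mp hle, by simp [hc0, hφ0]⟩)
    obtain ⟨z, -, hz⟩ := intermediate_value_uIcc (hsol s).continuous_fst.continuousOn hmem
    exact hne s hs z hz
  refine ⟨fun x => c x + s * φ x, fun x => c x + s' * φ x, ⟨_, (hsol s).solvesWith⟩,
    ⟨_, (hsol s').solvesWith⟩, hpos s ⟨hαs, hsβ⟩, hpos s' ⟨hαs.trans hss', hs'β⟩, ?_⟩
  rw [LinearIndependent.pair_iff]
  intro p q hpq
  have h0 := congrFun hpq 0
  have h1 := congrFun hpq 1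
  simp only [Pi.add_apply, Pi.smul_apply, smul_eq_mul, Pi.zero_apply, hc0, hφ0] at h0 h1
  have hq : q = -p := by linarith
  subst hq
  have hprod : p * ((s - s') * φ 1) = 0 := by linarith
  have hp : p = 0 := (mul_eq_zero.mp hprod).resolve_right
    (mul_ne_zero (sub_ne_zero.mpr hss'.ne) (hφne 1 one_ne_zero))
  exact ⟨hp, by rw [hp, neg_zero]⟩
end

section
/- Let T > 0, R > 0, set I = [−T, T], J = [−R, R] and Q = I × J. There exists a constant C > 0 depending only on R such that: for every measurable f : Q → ℝ for which f(t, ·) belongs to H¹(J) for almost every t ∈ I, the map t ↦ ‖f(t, ·)‖²_{H¹(J)} is integrable over I, and ess sup_{t ∈ I} ‖f(t, ·)‖_{L²(J)} < ∞, one has ∫∫_Q |f(t,x)|⁶ dt dx ≤ C · (ess sup_{t ∈ I} ‖f(t, ·)‖_{L²(J)})⁴ · ∫_I ‖f(t, ·)‖²_{H¹(J)} dt. In particular L²(I, H¹(J)) ∩ L^∞(I, L²(J)) embeds continuously into L⁶(Q). -/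
open MeasureTheory Filter Set intervalIntegral ENNReal

/-- Cauchy-Schwarz against the constant function on a set of finite measure. -/
theorem sq_setIntegral_le_mul_setIntegral_sq {α : Type*} [MeasurableSpace α] {μ : Measure α}
    {s : Set α} (hs : μ s ≠ ∞) {h : α → ℝ} (h1 : IntegrableOn h s μ)
    (h2 : IntegrableOn (fun x => h x ^ 2) s μ) :
    (∫ x in s, h x ∂μ) ^ 2 ≤ μ.real s * ∫ x in s, h x ^ 2 ∂μ := by
  rcases eq_or_ne (μ s) 0 with h0 | h0
  · simp [Measure.restrict_eq_zero.2 h0, Measure.real, h0]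
  have hL : 0 < μ.real s := ENNReal.toReal_pos h0 hs
  have hc : ∀ c : ℝ, IntegrableOn (fun _ : α => c) s μ := fun c => integrableOn_const hs
  set m : ℝ := (∫ x in s, h x ∂μ) / μ.real s with hm
  have key : 0 ≤ ∫ x in s, (h x ^ 2 - 2 * m * h x + m ^ 2) ∂μ :=
    integral_nonneg fun x => by
      show 0 ≤ h x ^ 2 - 2 * m * h x + m ^ 2
      nlinarith [sq_nonneg (h x - m)]
  have hsub : IntegrableOn (fun x => h x ^ 2 - 2 * m * h x) s μ := h2.sub (h1.const_mul _)
  rw [MeasureTheory.integral_add hsub (hc _), MeasureTheory.integral_sub h2 (h1.const_mul _),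
    MeasureTheory.integral_const_mul, setIntegral_const, smul_eq_mul] at key
  have hI : ∫ x in s, h x ∂μ = m * μ.real s := by rw [hm]; field_simp
  rw [hI] at key ⊢
  nlinarith [mul_nonneg hL.le key]

/-- Optimizing a family of interpolation bounds over the scale `δ`. -/
theorem sq_le_of_forall_le_div_add_mul {R A B p : ℝ} (hR : 0 < R) (hA : 0 ≤ A) (hAB : A ≤ B)
    (hp : 0 ≤ p) (h : ∀ δ, 0 < δ → δ ≤ R → δ * p ≤ 2 * A + 2 * δ ^ 2 * B) :
    p ^ 2 ≤ (2 / R + 2 * R) ^ 2 * (A * B) := by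
  rcases hA.eq_or_lt with rfl | hA
  · have hp0 : p ≤ 0 := by
      by_contra! hpos
      have hδ : 0 < min R (p / (4 * (B + 1))) := by positivity
      have h1 := h _ hδ (min_le_left _ _)
      have h2 : min R (p / (4 * (B + 1))) * (4 * (B + 1)) ≤ p :=
        (le_div_iff₀ (by positivity)).1 (min_le_right _ _)
      nlinarith
    simp [le_antisymm hp0 hp]
  have hB : 0 < B := hA.trans_le hAB
  set a := √A with ha
  set b := √B with hb
  have ha0 : 0 < a := Real.sqrt_pos.2 hA
  have hb0 : 0 < b := Real.sqrt_pos.2 hB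
  have hab : a ≤ b := Real.sqrt_le_sqrt hAB
  have hA2 : A = a ^ 2 := (Real.sq_sqrt hA.le).symm
  have hB2 : B = b ^ 2 := (Real.sq_sqrt hB.le).symm
  have h1 := h (R * (a / b)) (by positivity)
    (mul_le_of_le_one_right hR.le ((div_le_one hb0).2 hab))
  have h2 : p ≤ (2 / R + 2 * R) * (a * b) := by
    rw [hA2, hB2] at h1
    refine le_of_mul_le_mul_left (h1.trans_eq ?_) (show 0 < R * (a / b) by positivity)
    field_simp
  calc p ^ 2 ≤ ((2 / R + 2 * R) * (a * b)) ^ 2 := by gcongr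
    _ = _ := by rw [hA2, hB2]; ring

/-- Pointwise bound of `g ∈ H¹(J)` at a point, averaging over a subinterval of length `δ`. -/
theorem mul_sq_le_of_primitive {R δ : ℝ} (hδ : 0 < δ) (hδR : δ ≤ R) {g g' : ℝ → ℝ}
    (hg'm : AEStronglyMeasurable g' (volume.restrict (Icc (-R) R)))
    (hg : IntegrableOn (fun x => g x ^ 2) (Icc (-R) R))
    (hg' : IntegrableOn (fun x => g' x ^ 2) (Icc (-R) R))
    (hprim : ∀ x ∈ Icc (-R) R, ∀ y ∈ Icc (-R) R, g y = g x + ∫ s in x..y, g' s)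
    {x : ℝ} (hx : x ∈ Icc (-R) R) :
    δ * g x ^ 2 ≤ 2 * (∫ y in Icc (-R) R, g y ^ 2) +
      2 * δ ^ 2 * ∫ y in Icc (-R) R, g' y ^ 2 := by
  obtain ⟨a, hxa, hsub⟩ : ∃ a, x ∈ Icc a (a + δ) ∧ Icc a (a + δ) ⊆ Icc (-R) R := by
    rcases le_total x 0 with h | h
    · exact ⟨x, ⟨le_rfl, by linarith⟩, Icc_subset_Icc hx.1 (by linarith)⟩
    · exact ⟨x - δ, ⟨by linarith, by linarith⟩, Icc_subset_Icc (by linarith) (by linarith [hx.2])⟩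
  have hg'1 : IntegrableOn g' (Icc (-R) R) :=
    ((memLp_two_iff_integrable_sq hg'm).2 hg').integrable one_le_two
  set B := ∫ y in Icc (-R) R, g' y ^ 2
  have hinc : ∀ y ∈ Icc a (a + δ), g x ^ 2 ≤ 2 * g y ^ 2 + 2 * (δ * B) := by
    intro y hy
    have hUI : uIoc y x ⊆ Icc a (a + δ) := uIoc_subset_uIcc.trans (uIcc_subset_Icc hy hxa)
    have hU : uIoc y x ⊆ Icc (-R) R := hUI.trans hsub
    have hvol : volume (uIoc y x) ≠ ∞ := by simp
    have hCS := sq_setIntegral_le_mul_setIntegral_sq hvol (hg'1.mono_set hU) (hg'.mono_set hU)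
    have hreal : volume.real (uIoc y x) ≤ δ := by
      refine (measureReal_mono hUI (by simp)).trans_eq ?_
      simp [hδ.le]
    have hmono : ∫ s in uIoc y x, g' s ^ 2 ≤ B :=
      setIntegral_mono_set hg' (Eventually.of_forall fun _ => sq_nonneg _) hU.eventuallyLE
    have hsq : (∫ s in y..x, g' s) ^ 2 ≤ δ * B := by
      rw [← sq_abs, abs_integral_eq_abs_integral_uIoc, sq_abs]
      exact hCS.trans (mul_le_mul hreal hmono (integral_nonneg fun _ => sq_nonneg _) hδ.le)
    rw [hprim y (hsub hy) x hx]
    nlinarith [sq_nonneg (g y - ∫ s in y..x, g' s)]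
  have hc : ∀ c : ℝ, IntegrableOn (fun _ : ℝ => c) (Icc a (a + δ)) :=
    fun c => integrableOn_const (by simp)
  have hgK := (hg.mono_set hsub).const_mul 2
  have hint := setIntegral_mono_on (hc (g x ^ 2)) (hgK.add (hc (2 * (δ * B))))
    measurableSet_Icc hinc
  have hKJ : ∫ y in Icc a (a + δ), g y ^ 2 ≤ ∫ y in Icc (-R) R, g y ^ 2 :=
    setIntegral_mono_set hg (Eventually.of_forall fun _ => sq_nonneg _) hsub.eventuallyLE
  have hvol : volume.real (Icc a (a + δ)) = δ := by simp [hδ.le]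
  simp only [Pi.add_apply] at hint
  rw [MeasureTheory.integral_add hgK (hc _), MeasureTheory.integral_const_mul, setIntegral_const, setIntegral_const,
    hvol, smul_eq_mul, smul_eq_mul] at hint
  linarith

/-- One-dimensional Gagliardo-Nirenberg inequality on `[-R, R]` for the sixth power. -/
theorem lintegral_pow_six_le_of_primitive {R : ℝ} (hR : 0 < R) {g g' : ℝ → ℝ}
    (hg'm : AEStronglyMeasurable g' (volume.restrict (Icc (-R) R)))
    (hg : IntegrableOn (fun x => g x ^ 2) (Icc (-R) R))
    (hg' : IntegrableOn (fun x => g' x ^ 2) (Icc (-R) R))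
    (hprim : ∀ x ∈ Icc (-R) R, ∀ y ∈ Icc (-R) R, g y = g x + ∫ s in x..y, g' s) :
    ∫⁻ x in Icc (-R) R, ENNReal.ofReal (g x ^ 6) ≤
      ENNReal.ofReal ((2 / R + 2 * R) ^ 2 * (∫ x in Icc (-R) R, g x ^ 2) ^ 2 *
        ∫ x in Icc (-R) R, (g x ^ 2 + g' x ^ 2)) := by
  have hB : ∫ x in Icc (-R) R, (g x ^ 2 + g' x ^ 2) =
      (∫ x in Icc (-R) R, g x ^ 2) + ∫ x in Icc (-R) R, g' x ^ 2 := integral_add hg hg'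
  have hA0 : 0 ≤ ∫ x in Icc (-R) R, g x ^ 2 := integral_nonneg fun _ => sq_nonneg _
  have hD0 : 0 ≤ ∫ x in Icc (-R) R, g' x ^ 2 := integral_nonneg fun _ => sq_nonneg _
  set A := ∫ x in Icc (-R) R, g x ^ 2
  set B := ∫ x in Icc (-R) R, (g x ^ 2 + g' x ^ 2)
  have hpt : ∀ x ∈ Icc (-R) R, g x ^ 6 ≤ (2 / R + 2 * R) ^ 2 * (A * B) * g x ^ 2 := by
    intro x hx
    have h4 := sq_le_of_forall_le_div_add_mul hR hA0 (by linarith : A ≤ B) (sq_nonneg (g x))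
      fun δ hδ hδR => (mul_sq_le_of_primitive hδ hδR hg'm hg hg' hprim hx).trans (by
        gcongr; linarith)
    calc g x ^ 6 = (g x ^ 2) ^ 2 * g x ^ 2 := by ring
      _ ≤ _ := by gcongr
  calc ∫⁻ x in Icc (-R) R, ENNReal.ofReal (g x ^ 6)
      ≤ ∫⁻ x in Icc (-R) R, ENNReal.ofReal ((2 / R + 2 * R) ^ 2 * (A * B) * g x ^ 2) :=
        setLIntegral_mono' measurableSet_Icc fun x hx => ENNReal.ofReal_le_ofReal (hpt x hx)
    _ = ENNReal.ofReal (∫ x in Icc (-R) R, (2 / R + 2 * R) ^ 2 * (A * B) * g x ^ 2) := by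
        refine (ofReal_integral_eq_lintegral_ofReal (hg.const_mul _)
          (Eventually.of_forall fun x => ?_)).symm
        have : 0 ≤ B := by linarith
        positivity
    _ = _ := by
        rw [MeasureTheory.integral_const_mul]
        congr 1
        ring

/-- **Lemma (anisotropic `L⁶` estimate).** Let `I = [-T,T]`, `J = [-R,R]`, `Q = I × J`. There
is a constant `C > 0` depending only on `R` such that for every measurable `f` with
`f(t,·) ∈ H¹(J)` for a.e. `t ∈ I` (with `x`-derivative `fx`, encoded by the integral
equation), `t ↦ ‖f(t,·)‖²_{H¹(J)}` integrable on `I`, and `ess sup_{t∈I} ‖f(t,·)‖_{L²(J)}`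
finite, one has
`∫∫_Q |f|⁶ ≤ C (ess sup_{t∈I} ‖f(t,·)‖_{L²(J)})⁴ ∫_I ‖f(t,·)‖²_{H¹(J)} dt`.
In particular `L²(I,H¹(J)) ∩ L^∞(I,L²(J))` embeds continuously into `L⁶(Q)`. -/
theorem L6_embedding (R : ℝ) (hR : 0 < R) :
    ∃ C > (0:ℝ), ∀ T : ℝ, 0 < T → ∀ f fx : ℝ → ℝ → ℝ,
      Measurable (fun p : ℝ × ℝ => f p.1 p.2) →
      Measurable (fun p : ℝ × ℝ => fx p.1 p.2) →
      (∀ᵐ t ∂(volume.restrict (Set.Icc (-T) T)),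
        IntegrableOn (fun x => f t x ^ 2) (Set.Icc (-R) R) volume ∧
        IntegrableOn (fun x => fx t x ^ 2) (Set.Icc (-R) R) volume ∧
        ∀ x ∈ Set.Icc (-R) R, ∀ y ∈ Set.Icc (-R) R,
          f t y = f t x + ∫ s in x..y, fx t s) →
      IntegrableOn (fun t => ∫ x in Set.Icc (-R) R, (f t x ^ 2 + fx t x ^ 2))
        (Set.Icc (-T) T) volume →
      (∃ M : ℝ, ∀ᵐ t ∂(volume.restrict (Set.Icc (-T) T)),
        (∫ x in Set.Icc (-R) R, f t x ^ 2) ≤ M) →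
      (∫⁻ p in (Set.Icc (-T) T) ×ˢ (Set.Icc (-R) R), ENNReal.ofReal (f p.1 p.2 ^ 6)) ≤
        ENNReal.ofReal (C *
          (essSup (fun t => Real.sqrt (∫ x in Set.Icc (-R) R, f t x ^ 2))
              (volume.restrict (Set.Icc (-T) T))) ^ 4 *
          ∫ t in Set.Icc (-T) T, ∫ x in Set.Icc (-R) R, (f t x ^ 2 + fx t x ^ 2)) := by
  refine ⟨(2 / R + 2 * R) ^ 2, by positivity, ?_⟩
  rintro T - f fx hf hfx hH1 hint ⟨M, hM⟩
  set S := essSup (fun t => √(∫ x in Icc (-R) R, f t x ^ 2)) (volume.restrict (Icc (-T) T))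
  have hS : ∀ᵐ t ∂(volume.restrict (Icc (-T) T)), √(∫ x in Icc (-R) R, f t x ^ 2) ≤ S :=
    ae_le_essSup ⟨√M, eventually_map.2 (hM.mono fun t ht => Real.sqrt_le_sqrt ht)⟩
  have hslice : ∀ᵐ t ∂(volume.restrict (Icc (-T) T)),
      ∫⁻ x in Icc (-R) R, ENNReal.ofReal (f t x ^ 6) ≤
        ENNReal.ofReal ((2 / R + 2 * R) ^ 2 * S ^ 4 *
          ∫ x in Icc (-R) R, (f t x ^ 2 + fx t x ^ 2)) := by
    filter_upwards [hH1, hS] with t ⟨h1, h2, h3⟩ hSt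
    refine (lintegral_pow_six_le_of_primitive (g' := fx t) hR
      (hfx.comp measurable_prodMk_left).aestronglyMeasurable h1 h2 h3).trans
      (ENNReal.ofReal_le_ofReal ?_)
    have hA0 : 0 ≤ ∫ x in Icc (-R) R, f t x ^ 2 := integral_nonneg fun _ => sq_nonneg _
    have hB0 : 0 ≤ ∫ x in Icc (-R) R, (f t x ^ 2 + fx t x ^ 2) :=
      integral_nonneg fun _ => by positivity
    have hA2 : (∫ x in Icc (-R) R, f t x ^ 2) ^ 2 ≤ S ^ 4 := by
      calc (∫ x in Icc (-R) R, f t x ^ 2) ^ 2 = √(∫ x in Icc (-R) R, f t x ^ 2) ^ 4 := by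
            rw [show 4 = 2 * 2 from rfl, pow_mul, Real.sq_sqrt hA0]
        _ ≤ S ^ 4 := by gcongr
    gcongr
  rw [Measure.volume_eq_prod, ← Measure.prod_restrict,
    lintegral_prod _ (hf.pow_const 6).ennreal_ofReal.aemeasurable]
  refine (lintegral_mono_ae hslice).trans_eq ?_
  rw [← MeasureTheory.integral_const_mul]
  refine (ofReal_integral_eq_lintegral_ofReal (hint.const_mul _)
    (Eventually.of_forall fun t => ?_)).symm
  have hB0 : 0 ≤ ∫ x in Icc (-R) R, (f t x ^ 2 + fx t x ^ 2) :=
    integral_nonneg fun _ => by positivity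
  positivity
end
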